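/- arXiv:2509.02561 — 2 statements merged into one kernel-verified Lean document; each statement's English description precedes it below -/
import Mathlib

section
/- There exist absolute constants ξ, c > 0 such that the following holds. Let G be a finite abelian group of order n ≥ 2 and let p ∈ (0, 1/2]. Let S be a random symmetric subset of G obtained by including each equivalence class {x, −x} (x ∈ G, x ≠ 0) independently with probability p. Then with probability at least 1 − exp(−c·p^{−1/2}·(log n)^{11/4}), every subset B ⊆ G such that no two distinct elements b, b′ ∈ B satisfy b − b′ ∈ S has size |B| ≤ ξ·p^{−3/2}·(log n)^{19/4}. -/
open scoped Pointwise Classical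
open Finset

section Bernoulli

variable {α : Type*} [DecidableEq α]

theorem sum_powerset_disjoint_bernoulli (p : ℝ) {s A : Finset α} (hA : A ⊆ s) :
    ∑ T ∈ s.powerset with Disjoint T A, p ^ T.card * (1 - p) ^ (s.card - T.card)
      = (1 - p) ^ A.card := by
  have hfilter : s.powerset.filter (fun T => Disjoint T A) = (s \ A).powerset := by
    ext T
    simp only [mem_filter, mem_powerset, subset_sdiff]
  rw [hfilter]
  have hterm : ∀ T ∈ (s \ A).powerset, p ^ T.card * (1 - p) ^ (s.card - T.card)
      = p ^ T.card * (1 - p) ^ ((s \ A).card - T.card) * (1 - p) ^ A.card := by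
    intro T hT
    have h1 := card_le_card (mem_powerset.1 hT)
    have h2 := card_sdiff_add_card_eq_card hA
    rw [mul_assoc, ← pow_add]
    congr 2
    omega
  rw [sum_congr rfl hterm, ← sum_mul, Finset.sum_pow_mul_eq_add_pow]
  simp

end Bernoulli

section UnionBound

theorem card_image_pair_ge {G : Type*} [AddCommGroup G] [DecidableEq G] (D : Finset G) :
    ((D.card : ℝ) - 1) / 2
      ≤ (((D.erase 0).image fun x => ({x, -x} : Finset G)).card : ℝ) := by
  have h := card_le_mul_card_image (f := fun x => ({x, -x} : Finset G)) (D.erase 0) 2 (by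
    intro A hA
    obtain ⟨x, -, rfl⟩ := mem_image.1 hA
    refine (card_le_card ?_).trans (card_le_two (a := x) (b := -x))
    intro y hy
    have hy' := (mem_filter.1 hy).2
    rw [← hy']
    simp)
  have h' : D.card ≤ (D.erase 0).card + 1 := by
    have := pred_card_le_card_erase (s := D) (a := 0)
    omega
  have : (D.card : ℝ) ≤ 2 * (((D.erase 0).image fun x => ({x, -x} : Finset G)).card : ℝ) + 1 := by
    exact_mod_cast h'.trans (Nat.add_le_add_right h 1)
  linarith

variable {G : Type} [AddCommGroup G] [Fintype G] [DecidableEq G]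

/-- If the difference set of every set larger than `M` contains a member of `𝓓`, then the
independence number exceeds `M` with probability at most the sum over `D ∈ 𝓓` of the bound
`exp (-p (|D| - 1) / 2)` for the probability that no nonzero element of `D` is selected. -/
theorem one_sub_sum_le_prob_indep {p M : ℝ} (hp0 : 0 < p) (hp1 : p ≤ 1 / 2)
    (𝓓 : Finset (Finset G))
    (h𝓓 : ∀ B : Finset G, M < (B.card : ℝ) →
      ∃ D ∈ 𝓓, ∀ x ∈ D, ∃ b ∈ B, ∃ b' ∈ B, b - b' = x) :
    let classes : Finset (Finset G) :=
      ((Finset.univ : Finset G).erase 0).image fun x => ({x, -x} : Finset G)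
    1 - ∑ D ∈ 𝓓, Real.exp (-(p * (((D.card : ℝ) - 1) / 2)))
      ≤ ∑ T ∈ classes.powerset,
          (if ∀ B : Finset G,
                (∀ b ∈ B, ∀ b' ∈ B, b ≠ b' → b - b' ∉ T.sup id) → (B.card : ℝ) ≤ M
            then p ^ T.card * (1 - p) ^ (classes.card - T.card) else 0) := by
  intro classes
  set w : Finset (Finset G) → ℝ := fun T => p ^ T.card * (1 - p) ^ (classes.card - T.card)
    with hw
  have hw0 : ∀ T, 0 ≤ w T := fun T =>
    mul_nonneg (pow_nonneg hp0.le _) (pow_nonneg (by linarith) _)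
  have hsum : ∑ T ∈ classes.powerset, w T = 1 := by
    rw [hw, Finset.sum_pow_mul_eq_add_pow]; simp
  set A : Finset G → Finset (Finset G) :=
    fun D => (D.erase 0).image fun x => ({x, -x} : Finset G) with hA
  have hAsub : ∀ D, A D ⊆ classes := fun D =>
    image_subset_image (erase_subset_erase 0 (subset_univ D))
  have hprob : ∀ D, ∑ T ∈ classes.powerset with Disjoint T (A D), w T
      ≤ Real.exp (-(p * (((D.card : ℝ) - 1) / 2))) := by
    intro D
    rw [hw, sum_powerset_disjoint_bernoulli p (hAsub D)]
    calc (1 - p) ^ (A D).card ≤ Real.exp (-p) ^ (A D).card :=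
          pow_le_pow_left₀ (by linarith) (Real.one_sub_le_exp_neg p) _
      _ = Real.exp (-(p * (A D).card)) := by rw [← Real.exp_nat_mul]; congr 1; ring
      _ ≤ _ := by
          apply Real.exp_le_exp.2
          have := mul_le_mul_of_nonneg_left (card_image_pair_ge D) hp0.le
          linarith
  have hpoint : ∀ T ∈ classes.powerset, w T ≤
      (if ∀ B : Finset G,
          (∀ b ∈ B, ∀ b' ∈ B, b ≠ b' → b - b' ∉ T.sup id) → (B.card : ℝ) ≤ M
        then w T else 0) + ∑ D ∈ 𝓓, if Disjoint T (A D) then w T else 0 := by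
    intro T _
    have hnn : 0 ≤ ∑ D ∈ 𝓓, if Disjoint T (A D) then w T else 0 :=
      sum_nonneg fun D _ => by split_ifs <;> simp [hw0]
    split_ifs with hgood
    · linarith
    · push Not at hgood
      obtain ⟨B, hB, hBM⟩ := hgood
      obtain ⟨D, hD, hDB⟩ := h𝓓 B hBM
      have hdis : Disjoint T (A D) := by
        rw [disjoint_right]
        intro c hc hcT
        obtain ⟨x, hx, rfl⟩ := mem_image.1 hc
        obtain ⟨hx0, hxD⟩ := mem_erase.1 hx
        obtain ⟨b, hb, b', hb', rfl⟩ := hDB x hxD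
        exact hB b hb b' hb' (sub_ne_zero.1 hx0) (mem_sup.2 ⟨_, hcT, by simp⟩)
      have := single_le_sum (f := fun D => if Disjoint T (A D) then w T else 0)
        (fun D _ => by split_ifs <;> simp [hw0]) hD
      simp only [hdis, if_true] at this
      linarith
  have htotal := sum_le_sum hpoint
  rw [hsum, sum_add_distrib, sum_comm] at htotal
  have hle : ∑ D ∈ 𝓓, ∑ T ∈ classes.powerset, (if Disjoint T (A D) then w T else 0)
      ≤ ∑ D ∈ 𝓓, Real.exp (-(p * (((D.card : ℝ) - 1) / 2))) :=
    sum_le_sum fun D _ => by rw [← sum_filter]; exact hprob D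
  linarith

end UnionBound

section Sampling

/-- A few samples from a distribution approximate simultaneously the means of finitely many
functions bounded by one. -/
theorem exists_sample_abs_sum_sub_lt {α X : Type*} [Fintype α] [Fintype X]
    (ν : α → ℝ) (hν0 : ∀ a, 0 ≤ ν a) (hν1 : ∑ a, ν a = 1)
    (g : X → α → ℝ) (hg : ∀ x a, |g x a| ≤ 1) {t : ℝ} (ht : 1 ≤ t) {s : ℕ}
    (hs : 16 * t ^ 2 * Real.log (2 * Fintype.card X) < s) :
    ∃ c : Fin s → α, ∀ x, |∑ i, g x (c i) - s * ∑ a, ν a * g x a| < s / (2 * t) := by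
  rcases isEmpty_or_nonempty X with hX | hX
  · have : Nonempty α := by
      by_contra h
      rw [not_nonempty_iff] at h
      simp at hν1
    exact ⟨fun _ => Classical.arbitrary α, fun x => (hX.false x).elim⟩
  set μ : X → ℝ := fun x => ∑ a, ν a * g x a with hμ
  set l : ℝ := 1 / (4 * t) with hl
  have ht0 : 0 < t := by linarith
  have hl0 : 0 < l := by positivity
  have hl4 : l ≤ 1 / 4 := by
    rw [hl]; apply one_div_le_one_div_of_le <;> linarith
  have hμ1 : ∀ x, |μ x| ≤ 1 := by
    intro x
    calc |μ x| ≤ ∑ a, |ν a * g x a| := abs_sum_le_sum_abs _ _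
      _ ≤ ∑ a, ν a := sum_le_sum fun a _ => by
          rw [abs_mul, abs_of_nonneg (hν0 a)]
          exact mul_le_of_le_one_right (hν0 a) (hg x a)
      _ = 1 := hν1
  have hmgf : ∀ x (e : ℝ), |e| = 1 →
      ∑ a, ν a * Real.exp (l * (e * (g x a - μ x))) ≤ Real.exp (l ^ 2) := by
    intro x e he
    have he2 : e ^ 2 = 1 := by rw [← sq_abs, he]; norm_num
    have hterm : ∀ a, Real.exp (l * (e * (g x a - μ x)))
        ≤ 1 + l * e * (g x a - μ x) + l ^ 2 * (g x a - μ x) ^ 2 := by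
      intro a
      have habs : |l * (e * (g x a - μ x))| ≤ 1 := by
        rw [abs_mul, abs_mul, he, abs_of_pos hl0, one_mul]
        have : |g x a - μ x| ≤ 2 := (abs_sub _ _).trans (by linarith [hg x a, hμ1 x])
        nlinarith [abs_nonneg (g x a - μ x)]
      have h := (abs_le.1 (Real.abs_exp_sub_one_sub_id_le habs)).2
      have : (l * (e * (g x a - μ x))) ^ 2 = l ^ 2 * (g x a - μ x) ^ 2 := by
        rw [mul_pow, mul_pow, he2, one_mul]
      linarith
    have hvar : ∑ a, ν a * (g x a - μ x) ^ 2 ≤ 1 := by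
      have h1 : ∑ a, ν a * (g x a - μ x) ^ 2
          = ∑ a, ν a * g x a ^ 2 - 2 * μ x * ∑ a, ν a * g x a + μ x ^ 2 * ∑ a, ν a := by
        rw [mul_sum _ _ (2 * μ x), mul_sum _ _ (μ x ^ 2), ← sum_sub_distrib, ← sum_add_distrib]
        exact sum_congr rfl fun a _ => by ring
      have h2 : ∑ a, ν a * g x a ^ 2 ≤ ∑ a, ν a := sum_le_sum fun a _ =>
        mul_le_of_le_one_right (hν0 a) ((sq_le_one_iff_abs_le_one _).2 (hg x a))
      rw [h1, hν1]
      change _ - 2 * μ x * μ x + _ ≤ _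
      nlinarith [sq_nonneg (μ x)]
    calc ∑ a, ν a * Real.exp (l * (e * (g x a - μ x)))
        ≤ ∑ a, ν a * (1 + l * e * (g x a - μ x) + l ^ 2 * (g x a - μ x) ^ 2) :=
          sum_le_sum fun a _ => mul_le_mul_of_nonneg_left (hterm a) (hν0 a)
      _ = ∑ a, ν a + l * e * (∑ a, ν a * g x a - μ x * ∑ a, ν a)
            + l ^ 2 * ∑ a, ν a * (g x a - μ x) ^ 2 := by
          simp only [mul_sum, ← sum_sub_distrib, ← sum_add_distrib]
          exact sum_congr rfl fun a _ => by ring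
      _ ≤ 1 + l ^ 2 := by
          rw [hν1]
          change _ + l * e * (μ x - μ x * 1) + _ ≤ _
          nlinarith [sq_nonneg l]
      _ ≤ Real.exp (l ^ 2) := by linarith [Real.add_one_le_exp (l ^ 2)]
  set E : X → ℝ → (Fin s → α) → ℝ :=
    fun x e c => ∏ i, Real.exp (l * (e * (g x (c i) - μ x))) with hE
  have hE0 : ∀ x e c, 0 < E x e c := fun x e c => prod_pos fun i _ => Real.exp_pos _
  set F : (Fin s → α) → ℝ := fun c => ∑ x, (E x 1 c + E x (-1) c) with hF
  set W : (Fin s → α) → ℝ := fun c => ∏ i, ν (c i) with hW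
  set K : ℝ := 2 * Fintype.card X * Real.exp (l ^ 2) ^ s with hK
  have hW0 : ∀ c, 0 ≤ W c := fun c => prod_nonneg fun i _ => hν0 _
  have hW1 : ∑ c, W c = 1 := by rw [hW, ← Fintype.sum_pow, hν1, one_pow]
  have hWE : ∀ x (e : ℝ), |e| = 1 → ∑ c, W c * E x e c ≤ Real.exp (l ^ 2) ^ s := by
    intro x e he
    simp only [hW, hE, ← prod_mul_distrib]
    rw [← Fintype.sum_pow (fun a => ν a * Real.exp (l * (e * (g x a - μ x))))]
    exact pow_le_pow_left₀ (sum_nonneg fun a _ => mul_nonneg (hν0 a) (Real.exp_pos _).le)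
      (hmgf x e he) s
  have hWF : ∑ c, W c * F c ≤ K := by
    simp only [hF, mul_sum]
    rw [sum_comm]
    calc ∑ x, ∑ c, W c * (E x 1 c + E x (-1) c)
        ≤ ∑ _x : X, 2 * Real.exp (l ^ 2) ^ s := sum_le_sum fun x _ => by
          simp only [mul_add, sum_add_distrib]
          linarith [hWE x 1 (by simp), hWE x (-1) (by simp)]
      _ = K := by simp [hK]; ring
  obtain ⟨c, hc⟩ : ∃ c, F c ≤ K := by
    by_contra! hcon
    have hnn : ∀ c ∈ (univ : Finset (Fin s → α)), 0 ≤ W c * (F c - K) := fun c _ =>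
      mul_nonneg (hW0 c) (by linarith [hcon c])
    have hzero : ∑ c, W c * (F c - K) = 0 := by
      refine le_antisymm ?_ (sum_nonneg hnn)
      simp only [mul_sub, sum_sub_distrib, ← sum_mul, hW1]
      linarith
    have hall : ∀ c, W c = 0 := fun c => by
      have := (sum_eq_zero_iff_of_nonneg hnn).1 hzero c (mem_univ c)
      exact (mul_eq_zero.1 this).resolve_right (by linarith [hcon c])
    simp [hall] at hW1
  refine ⟨c, fun x => ?_⟩
  have hcard : (0 : ℝ) < Fintype.card X := by exact_mod_cast Fintype.card_pos
  have hdev : ∀ e : ℝ, (e = 1 ∨ e = -1) →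
      e * (∑ i, g x (c i) - s * μ x) < s / (2 * t) := by
    intro e he
    have h1 : E x e c ≤ K := by
      have h2 : E x 1 c + E x (-1) c ≤ F c :=
        single_le_sum (f := fun x => E x 1 c + E x (-1) c)
          (fun x _ => (add_pos (hE0 x 1 c) (hE0 x (-1) c)).le) (mem_univ x)
      rcases he with rfl | rfl <;> linarith [hE0 x 1 c, hE0 x (-1) c]
    have h3 : E x e c = Real.exp (l * (e * (∑ i, g x (c i) - s * μ x))) := by
      simp only [hE]
      rw [← Real.exp_sum, ← mul_sum, ← mul_sum, sum_sub_distrib]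
      simp
    rw [h3, hK] at h1
    have h4 := Real.log_le_log (Real.exp_pos _) h1
    rw [Real.log_exp, Real.log_mul (by positivity) (by positivity), Real.log_pow,
      Real.log_exp] at h4
    have h5 : (s : ℝ) * l ^ 2 = s / (4 * t) * l := by rw [hl]; field_simp
    have h6 : Real.log (2 * Fintype.card X) < s / (4 * t) * l := by
      rw [hl, div_mul_div_comm, lt_div_iff₀ (by positivity)]
      linarith
    have h7 : l * (e * (∑ i, g x (c i) - s * μ x)) < l * (s / (2 * t)) := by
      have : l * (s / (2 * t)) = s / (4 * t) * l + s / (4 * t) * l := by field_simp; ring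
      linarith
    exact lt_of_mul_lt_mul_left h7 hl0.le
  rw [abs_lt]
  constructor
  · linarith [hdev (-1) (Or.inr rfl)]
  · linarith [hdev 1 (Or.inl rfl)]

end Sampling

section DiffCount

variable {G : Type} [AddCommGroup G] [DecidableEq G]

/-- The number of representations of `x` as a difference of two elements of `B`. -/
def diffCount (B : Finset G) (x : G) : ℝ :=
  ∑ b ∈ B, ∑ b' ∈ B, if b - b' = x then 1 else 0

theorem diffCount_nonneg (B : Finset G) (x : G) : 0 ≤ diffCount B x :=
  sum_nonneg fun _ _ => sum_nonneg fun _ _ => by split_ifs <;> norm_num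

theorem diffCount_le_card (B : Finset G) (x : G) : diffCount B x ≤ B.card := by
  calc diffCount B x ≤ ∑ _b ∈ B, (1 : ℝ) := by
        refine sum_le_sum fun b _ => ?_
        have : ∀ b', (b - b' = x) ↔ (b - x = b') := fun b' =>
          ⟨fun h => by rw [← h]; abel, fun h => by rw [← h]; abel⟩
        simp only [this, sum_ite_eq]
        split_ifs <;> norm_num
    _ = B.card := by simp

theorem diffCount_zero (B : Finset G) : diffCount B 0 = B.card := by
  simp [diffCount, sub_eq_zero]

theorem diffCount_eq_zero {B : Finset G} {x : G}
    (h : ¬ ∃ b ∈ B, ∃ b' ∈ B, b - b' = x) : diffCount B x = 0 :=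
  sum_eq_zero fun b hb => sum_eq_zero fun b' hb' =>
    if_neg fun hx => h ⟨b, hb, b', hb', hx⟩

theorem sum_mul_diffCount [Fintype G] (B : Finset G) (φ : G → ℝ) :
    ∑ x, φ x * diffCount B x = ∑ b ∈ B, ∑ b' ∈ B, φ (b - b') := by
  simp only [diffCount, mul_sum]
  rw [sum_comm]
  refine sum_congr rfl fun b _ => ?_
  rw [sum_comm]
  refine sum_congr rfl fun b' _ => ?_
  simp

theorem sum_diffCount [Fintype G] (B : Finset G) :
    ∑ x, diffCount B x = (B.card : ℝ) ^ 2 := by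
  have := sum_mul_diffCount B fun _ => 1
  simp only [one_mul] at this
  rw [this]
  simp [sq]

theorem exists_dyadic_popular [Fintype G] {B : Finset G} (hB : B.Nonempty) (J : ℕ) :
    ∑ x with (B.card : ℝ) ≤ 2 ^ J * diffCount B x, diffCount B x < (B.card : ℝ) ^ 2 / 2 ∨
    ∃ j ≤ J, (B.card : ℝ) * 2 ^ j / (4 * (J + 1))
      ≤ (#{x | (B.card : ℝ) ≤ 2 ^ j * diffCount B x} : ℝ) := by
  have hm : (0 : ℝ) < B.card := by exact_mod_cast hB.card_pos
  by_contra! hcon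
  obtain ⟨h1, h2⟩ := hcon
  have hpoint : ∀ (J : ℕ) (x : G), (if (B.card : ℝ) ≤ 2 ^ J * diffCount B x then
      diffCount B x else 0) ≤ ∑ j ∈ range (J + 1),
        if (B.card : ℝ) ≤ 2 ^ j * diffCount B x then 2 * (B.card : ℝ) / 2 ^ j else 0 := by
    intro J x
    have hrm := diffCount_le_card B x
    induction J with
    | zero =>
      simp only [pow_zero, one_mul, zero_add, range_one, sum_singleton, div_one]
      split_ifs <;> linarith
    | succ J ih =>
      rw [sum_range_succ]
      have hnn : (0 : ℝ) ≤ if (B.card : ℝ) ≤ 2 ^ (J + 1) * diffCount B x then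
          2 * (B.card : ℝ) / 2 ^ (J + 1) else 0 := by split_ifs <;> positivity
      by_cases h : (B.card : ℝ) ≤ 2 ^ J * diffCount B x
      · rw [if_pos h] at ih
        have : (if (B.card : ℝ) ≤ 2 ^ (J + 1) * diffCount B x then diffCount B x else 0)
            ≤ diffCount B x := by
          split_ifs
          · exact le_rfl
          · exact diffCount_nonneg B x
        linarith
      · rw [if_neg h] at ih
        split_ifs with h'
        · have : diffCount B x ≤ 2 * (B.card : ℝ) / 2 ^ (J + 1) := by
            rw [le_div_iff₀ (by positivity), pow_succ]
            push Not at h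
            nlinarith
          linarith
        · linarith
  have hsum : ∑ x with (B.card : ℝ) ≤ 2 ^ J * diffCount B x, diffCount B x
      < (B.card : ℝ) ^ 2 / 2 := by
    rw [sum_filter]
    calc ∑ x, (if (B.card : ℝ) ≤ 2 ^ J * diffCount B x then diffCount B x else 0)
        ≤ ∑ x, ∑ j ∈ range (J + 1),
            if (B.card : ℝ) ≤ 2 ^ j * diffCount B x then 2 * (B.card : ℝ) / 2 ^ j else 0 :=
          sum_le_sum fun x _ => hpoint J x
      _ = ∑ j ∈ range (J + 1), (#{x | (B.card : ℝ) ≤ 2 ^ j * diffCount B x} : ℝ)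
            * (2 * (B.card : ℝ) / 2 ^ j) := by
          rw [sum_comm]
          refine sum_congr rfl fun j _ => ?_
          rw [← sum_filter, sum_const, nsmul_eq_mul]
      _ < ∑ j ∈ range (J + 1), (B.card : ℝ) ^ 2 / (2 * (J + 1)) := by
          refine sum_lt_sum_of_nonempty (by simp) fun j hj => ?_
          have h := h2 j (Nat.lt_succ_iff.1 (mem_range.1 hj))
          calc _ < (B.card : ℝ) * 2 ^ j / (4 * (J + 1)) * (2 * (B.card : ℝ) / 2 ^ j) :=
                mul_lt_mul_of_pos_right h (by positivity)
            _ = _ := by field_simp; ring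
      _ = (B.card : ℝ) ^ 2 / 2 := by
          rw [sum_const, card_range, nsmul_eq_mul]
          push_cast
          field_simp
  linarith

/-- The normalised difference counting function is a convex combination of characters, hence is
uniformly approximated by an average of few of them. -/
theorem exists_addChar_approx_diffCount [Fintype G] {B : Finset G} (hB : B.Nonempty)
    {t : ℝ} (ht : 1 ≤ t) {s : ℕ} (hs : 16 * t ^ 2 * Real.log (2 * Fintype.card G) < s) :
    ∃ c : Fin s → AddChar G ℂ, ∀ x,
      |∑ i, (c i x).re - s * (diffCount B x / B.card)| < s / (2 * t) := by
  have hm : (0 : ℝ) < B.card := by exact_mod_cast hB.card_pos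
  have hn : (0 : ℝ) < Fintype.card G := by
    exact_mod_cast Fintype.card_pos_iff.2 ⟨hB.choose⟩
  set ν : AddChar G ℂ → ℝ := fun χ =>
    ‖∑ b ∈ B, χ b‖ ^ 2 / (Fintype.card G * B.card) with hν
  have hsumν : ∀ x, ∑ χ, ν χ * (χ x).re = diffCount B x / B.card := by
    intro x
    have hcomplex : ∑ χ : AddChar G ℂ, ((‖∑ b ∈ B, χ b‖ ^ 2 : ℝ) : ℂ) * χ x
        = ((Fintype.card G * diffCount B x : ℝ) : ℂ) := by
      calc ∑ χ : AddChar G ℂ, ((‖∑ b ∈ B, χ b‖ ^ 2 : ℝ) : ℂ) * χ x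
          = ∑ χ : AddChar G ℂ, ∑ b ∈ B, ∑ b' ∈ B, χ (x - (b - b')) := by
            refine sum_congr rfl fun χ _ => ?_
            push_cast
            rw [← Complex.conj_mul', map_sum, sum_mul_sum, sum_mul]
            refine sum_congr rfl fun b _ => ?_
            rw [sum_mul]
            refine sum_congr rfl fun b' _ => ?_
            rw [← AddChar.map_neg_eq_conj, ← AddChar.map_add_eq_mul,
              ← AddChar.map_add_eq_mul]
            congr 1
            abel
        _ = ∑ b ∈ B, ∑ b' ∈ B, if b - b' = x then (Fintype.card G : ℂ) else 0 := by
            rw [sum_comm]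
            refine sum_congr rfl fun b _ => ?_
            rw [sum_comm]
            refine sum_congr rfl fun b' _ => ?_
            rw [AddChar.sum_apply_eq_ite]
            simp only [sub_eq_zero, eq_comm]
        _ = _ := by
            simp only [diffCount]
            push_cast
            simp only [mul_sum]
            refine sum_congr rfl fun b _ => sum_congr rfl fun b' _ => ?_
            split_ifs <;> simp
    have hre := congrArg Complex.re hcomplex
    rw [Complex.re_sum, Complex.ofReal_re] at hre
    simp only [Complex.re_ofReal_mul] at hre
    simp only [hν, div_mul_eq_mul_div]
    rw [← sum_div, hre]
    field_simp
  have hν1 : ∑ χ, ν χ = 1 := by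
    have h := hsumν 0
    simpa [diffCount_zero, hm.ne'] using h
  obtain ⟨c, hc⟩ := exists_sample_abs_sum_sub_lt ν (fun χ => by positivity) hν1
    (fun (x : G) (χ : AddChar G ℂ) => (χ x).re)
    (fun x χ => (Complex.abs_re_le_norm _).trans (by rw [AddChar.norm_apply])) ht hs
  refine ⟨c, fun x => ?_⟩
  have h := hc x
  rwa [hsumν x] at h

end DiffCount

section RandomSubset

open scoped BigOperators

theorem expect_pi_apply {ι β : Type*} [Fintype ι] [DecidableEq ι] [Fintype β] [Nonempty β]
    (i : ι) (f : β → ℝ) : 𝔼 u : ι → β, f (u i) = 𝔼 b, f b := by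
  rw [Fintype.expect_equiv (Equiv.funSplitAt i β) (fun u => f (u i)) (fun y => f y.1)
    (fun u => rfl), ← univ_product_univ, expect_product]
  exact expect_congr rfl fun b _ => Fintype.expect_const (f b)

theorem expect_pi_apply₂ {ι β : Type*} [Fintype ι] [DecidableEq ι] [Fintype β] [Nonempty β]
    {i j : ι} (hij : j ≠ i) (h : β → β → ℝ) :
    𝔼 u : ι → β, h (u i) (u j) = 𝔼 a, 𝔼 b, h a b := by
  rw [Fintype.expect_equiv (Equiv.funSplitAt i β) (fun u => h (u i) (u j))
    (fun y => h y.1 (y.2 ⟨j, hij⟩)) (fun u => rfl), ← univ_product_univ, expect_product]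
  exact expect_congr rfl fun a _ => expect_pi_apply (⟨j, hij⟩ : {j // j ≠ i}) (h a)

theorem expect_sum_sum_le {β : Type*} [Fintype β] [Nonempty β] {s : ℕ} (h : β → β → ℝ)
    (hh : ∀ a b, 0 ≤ h a b) :
    𝔼 u : Fin s → β, ∑ i, ∑ j, h (u i) (u j)
      ≤ s ^ 2 * 𝔼 a, 𝔼 b, h a b + s * 𝔼 a, h a a := by
  have h1 : ∀ i j : Fin s, 𝔼 u : Fin s → β, h (u i) (u j)
      ≤ 𝔼 a, 𝔼 b, h a b + if i = j then 𝔼 a, h a a else 0 := by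
    intro i j
    split_ifs with hij
    · subst hij
      rw [expect_pi_apply i (fun a => h a a)]
      exact le_add_of_nonneg_left (expect_nonneg fun a _ => expect_nonneg fun b _ => hh a b)
    · rw [expect_pi_apply₂ (Ne.symm hij) h, add_zero]
  simp only [expect_sum_comm]
  calc ∑ i : Fin s, ∑ j : Fin s, 𝔼 u : Fin s → β, h (u i) (u j)
      ≤ ∑ i : Fin s, ∑ j : Fin s, (𝔼 a, 𝔼 b, h a b + if i = j then 𝔼 a, h a a else 0) :=
        sum_le_sum fun i _ => sum_le_sum fun j _ => h1 i j
    _ = s ^ 2 * 𝔼 a, 𝔼 b, h a b + s * 𝔼 a, h a a := by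
        simp only [sum_add_distrib, sum_const, card_univ, Fintype.card_fin, nsmul_eq_mul,
          sum_ite_eq, mem_univ, if_true]
        ring

theorem expect_expect_sum_eq {β : Type*} [Fintype β] [Nonempty β] {s : ℕ} (f : β → β → ℝ) :
    𝔼 u : Fin s → β, 𝔼 v : Fin s → β, ∑ i, ∑ j, f (u i) (v j) = s ^ 2 * 𝔼 a, 𝔼 b, f a b := by
  simp only [expect_sum_comm]
  have h : ∀ i j : Fin s, 𝔼 u : Fin s → β, 𝔼 v : Fin s → β, f (u i) (v j)
      = 𝔼 a, 𝔼 b, f a b := by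
    intro i j
    have hv : ∀ a : β, 𝔼 v : Fin s → β, f a (v j) = 𝔼 b, f a b := fun a => expect_pi_apply j (f a)
    simp only [hv]
    exact expect_pi_apply i fun a => 𝔼 b, f a b
  simp only [h, sum_const, card_univ, Fintype.card_fin, nsmul_eq_mul]
  ring

theorem expect_expect_sum_le {β : Type*} [Fintype β] [Nonempty β] {s : ℕ}
    (g : β → β → β → β → ℝ) (hg : ∀ a a' b b', 0 ≤ g a a' b b') :
    𝔼 u : Fin s → β, 𝔼 v : Fin s → β, ∑ i, ∑ i', ∑ j, ∑ j', g (u i) (u i') (v j) (v j')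
      ≤ s ^ 2 * (s ^ 2 * 𝔼 a, 𝔼 a', 𝔼 b, 𝔼 b', g a a' b b' + s * 𝔼 a, 𝔼 a', 𝔼 b, g a a' b b)
        + (s ^ 2 * (s * 𝔼 a, 𝔼 b, 𝔼 b', g a a b b') + s ^ 2 * 𝔼 a, 𝔼 b, g a a b b) := by
  set F : β → β → ℝ := fun a a' => 𝔼 v : Fin s → β, ∑ j, ∑ j', g a a' (v j) (v j') with hF
  have hF0 : ∀ a a', 0 ≤ F a a' := fun a a' =>
    expect_nonneg fun v _ => sum_nonneg fun j _ => sum_nonneg fun j' _ => hg _ _ _ _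
  have hF1 : ∀ a a', F a a' ≤ s ^ 2 * 𝔼 b, 𝔼 b', g a a' b b' + s * 𝔼 b, g a a' b b :=
    fun a a' => expect_sum_sum_le (g a a') (hg a a')
  have hu : 𝔼 u : Fin s → β, 𝔼 v : Fin s → β, ∑ i, ∑ i', ∑ j, ∑ j', g (u i) (u i') (v j) (v j')
      = 𝔼 u : Fin s → β, ∑ i, ∑ i', F (u i) (u i') := by
    refine expect_congr rfl fun u _ => ?_
    rw [expect_sum_comm]
    exact sum_congr rfl fun i _ => expect_sum_comm _ _ _
  have e1 : 𝔼 a, 𝔼 a', F a a'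
      ≤ s ^ 2 * 𝔼 a, 𝔼 a', 𝔼 b, 𝔼 b', g a a' b b' + s * 𝔼 a, 𝔼 a', 𝔼 b, g a a' b b := by
    refine (expect_le_expect fun a _ => expect_le_expect fun a' _ => hF1 a a').trans_eq ?_
    simp only [expect_add_distrib, ← mul_expect]
  have e2 : 𝔼 a, F a a ≤ s ^ 2 * 𝔼 a, 𝔼 b, 𝔼 b', g a a b b' + s * 𝔼 a, 𝔼 b, g a a b b := by
    refine (expect_le_expect fun a _ => hF1 a a).trans_eq ?_
    simp only [expect_add_distrib, ← mul_expect]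
  rw [hu]
  refine (expect_sum_sum_le F hF0).trans (add_le_add
    (mul_le_mul_of_nonneg_left e1 (by positivity)) ?_)
  refine (mul_le_mul_of_nonneg_left e2 (by positivity)).trans_eq ?_
  ring

variable {G : Type} [AddCommGroup G] [Fintype G] [DecidableEq G]

theorem card_image_sub_ge {s : ℕ} (U : Finset G) (u v : Fin s → G) :
    (∑ i, ∑ j, if u i - v j ∈ U then (1 : ℝ) else 0) / 4
      - (∑ i, ∑ i', ∑ j, ∑ j',
          if u i - v j ∈ U ∧ u i - v j = u i' - v j' then (1 : ℝ) else 0) / 64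
      ≤ ((univ : Finset (Fin s × Fin s)).image fun ij => u ij.1 - v ij.2).card := by
  set D := (univ : Finset (Fin s × Fin s)).image fun ij => u ij.1 - v ij.2 with hD
  set N : G → ℝ := fun x => ∑ i, ∑ j, if u i - v j = x then (1 : ℝ) else 0 with hN
  have h1 : ∑ i, ∑ j, (if u i - v j ∈ U then (1 : ℝ) else 0) = ∑ x ∈ U, N x := by
    simp only [hN]
    symm
    rw [sum_comm]
    refine sum_congr rfl fun i _ => ?_
    rw [sum_comm]
    refine sum_congr rfl fun j _ => ?_
    simp
  have h2 : ∑ i, ∑ i', ∑ j, ∑ j',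
      (if u i - v j ∈ U ∧ u i - v j = u i' - v j' then (1 : ℝ) else 0)
      = ∑ x ∈ U, N x ^ 2 := by
    have hsq : ∀ x, N x ^ 2 = ∑ i, ∑ i', ∑ j, ∑ j',
        (if u i - v j = x then (1 : ℝ) else 0) * (if u i' - v j' = x then 1 else 0) := by
      intro x
      rw [sq]
      simp only [hN, sum_mul_sum]
    simp only [hsq]
    symm
    rw [sum_comm]
    refine sum_congr rfl fun i _ => ?_
    rw [sum_comm]
    refine sum_congr rfl fun i' _ => ?_
    rw [sum_comm]
    refine sum_congr rfl fun j _ => ?_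
    rw [sum_comm]
    refine sum_congr rfl fun j' _ => ?_
    simp only [ite_mul, one_mul, zero_mul, sum_ite_eq]
    rw [ite_and]
    simp only [eq_comm]
  have hcard : (D.card : ℝ) = ∑ x, if x ∈ D then (1 : ℝ) else 0 := by simp
  rw [h1, h2, hcard, sum_div, sum_div, ← sum_sub_distrib]
  calc ∑ x ∈ U, (N x / 4 - N x ^ 2 / 64)
      ≤ ∑ x ∈ U, if x ∈ D then (1 : ℝ) else 0 := by
        refine sum_le_sum fun x _ => ?_
        split_ifs with hx
        · nlinarith [sq_nonneg (N x / 8 - 1)]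
        · have : N x = 0 := sum_eq_zero fun i _ => sum_eq_zero fun j _ =>
            if_neg fun h => hx (mem_image.2 ⟨(i, j), mem_univ _, h⟩)
          simp [this]
    _ ≤ _ := sum_le_univ_sum_of_nonneg fun x => by split_ifs <;> norm_num

/-- If at least half of the pairs of elements of `B` have an unpopular difference, then few random
elements of `B` determine many differences. -/
theorem exists_sample_card_image_sub_ge {B : Finset G} (hB : B.Nonempty) {T : ℝ} (hT : 0 < T)
    (hpop : ∑ x with (B.card : ℝ) ≤ T * diffCount B x, diffCount B x ≤ (B.card : ℝ) ^ 2 / 2)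
    {s : ℕ} (hs1 : (s : ℝ) ^ 2 ≤ T * B.card) (hs2 : (s : ℝ) ≤ B.card) :
    ∃ u v : Fin s → G, (∀ i, u i ∈ B) ∧ (∀ i, v i ∈ B) ∧
      (s : ℝ) ^ 2 / 16
        ≤ ((univ : Finset (Fin s × Fin s)).image fun ij => u ij.1 - v ij.2).card := by
  have hm : (0 : ℝ) < B.card := by exact_mod_cast hB.card_pos
  have : Nonempty B := hB.to_subtype
  set m : ℝ := (B.card : ℝ) with hmdef
  set U : Finset G := {x | T * diffCount B x < m} with hU
  have havg : ∀ f : B → ℝ, 𝔼 a, f a = (∑ a, f a) / m := fun f => by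
    rw [Fintype.expect_eq_sum_div_card, Fintype.card_coe]
  have hf : 1 / 2 ≤ 𝔼 a : B, 𝔼 b : B, if (a : G) - b ∈ U then (1 : ℝ) else 0 := by
    have h1 : ∑ a : B, ∑ b : B, (if (a : G) - b ∈ U then (1 : ℝ) else 0)
        = ∑ x ∈ U, diffCount B x := by
      have h := sum_mul_diffCount B fun x => if x ∈ U then (1 : ℝ) else 0
      simp only [ite_mul, one_mul, zero_mul] at h
      rw [← sum_filter, filter_mem_eq_inter, univ_inter] at h
      rw [h, ← sum_coe_sort B]
      exact sum_congr rfl fun a _ => sum_coe_sort B fun b => if (a : G) - b ∈ U then (1 : ℝ) else 0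
    have h2 : ∑ x ∈ U, diffCount B x
        + ∑ x with m ≤ T * diffCount B x, diffCount B x = m ^ 2 := by
      rw [← sum_diffCount B, ← sum_filter_add_sum_filter_not univ (fun x => T * diffCount B x < m)]
      simp only [not_lt, hU]
    simp only [havg, ← sum_div]
    rw [h1, div_div, le_div_iff₀ (by positivity)]
    linarith
  set g : B → B → B → B → ℝ := fun a a' b b' =>
    if (a : G) - b ∈ U ∧ (a : G) - b = a' - b' then (1 : ℝ) else 0 with hg
  have hg0 : ∀ a a' b b', 0 ≤ g a a' b b' := fun a a' b b' => by
    simp only [hg]; split_ifs <;> norm_num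
  have hg1 : ∀ a a' b b', g a a' b b' ≤ 1 := fun a a' b b' => by
    simp only [hg]; split_ifs <;> norm_num
  have hE4 : s ^ 2 * 𝔼 a, 𝔼 a', 𝔼 b, 𝔼 b', g a a' b b' ≤ (1 : ℝ) := by
    have h1 : ∑ a, ∑ a', ∑ b, ∑ b', g a a' b b' = ∑ x ∈ U, diffCount B x * diffCount B x := by
      have h := sum_mul_diffCount B fun x => if x ∈ U then diffCount B x else 0
      simp only [ite_mul, zero_mul] at h
      rw [← sum_filter, filter_mem_eq_inter, univ_inter] at h
      rw [h, ← sum_coe_sort B]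
      refine sum_congr rfl fun a _ => ?_
      rw [sum_comm, ← sum_coe_sort B]
      refine sum_congr rfl fun b _ => ?_
      simp only [hg, diffCount]
      split_ifs with hab
      · rw [← sum_coe_sort B]
        refine sum_congr rfl fun a' _ => ?_
        rw [← sum_coe_sort B]
        refine sum_congr rfl fun b' _ => ?_
        simp only [hab, true_and, eq_comm]
      · simp [hab]
    have h2 : ∑ x ∈ U, diffCount B x * diffCount B x ≤ m / T * m ^ 2 := by
      calc ∑ x ∈ U, diffCount B x * diffCount B x ≤ ∑ x ∈ U, m / T * diffCount B x := by
            refine sum_le_sum fun x hx => mul_le_mul_of_nonneg_right ?_ (diffCount_nonneg B x)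
            rw [le_div_iff₀ hT, mul_comm]
            exact (mem_filter.1 hx).2.le
        _ ≤ ∑ x, m / T * diffCount B x := sum_le_univ_sum_of_nonneg fun x =>
            mul_nonneg (by positivity) (diffCount_nonneg B x)
        _ = _ := by rw [← mul_sum, sum_diffCount]
    simp only [havg, ← sum_div]
    rw [h1, div_div, div_div, div_div, ← mul_div_assoc, div_le_one (by positivity)]
    calc (s : ℝ) ^ 2 * ∑ x ∈ U, diffCount B x * diffCount B x
        ≤ (T * m) * (m / T * m ^ 2) :=
          mul_le_mul hs1 h2 (sum_nonneg fun x _ => mul_self_nonneg _) (by positivity)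
      _ = m * (m * (m * m)) := by field_simp
  have hsub : ∀ φ : B → B → ℝ, (∀ a b, φ a b ≤ if a = b then 1 else 0) →
      s * 𝔼 a, 𝔼 b, φ a b ≤ (1 : ℝ) := by
    intro φ hφ
    have h : ∑ a, ∑ b, φ a b ≤ m := by
      calc ∑ a, ∑ b, φ a b ≤ ∑ a : B, ∑ b : B, (if a = b then (1 : ℝ) else 0) :=
            sum_le_sum fun a _ => sum_le_sum fun b _ => hφ a b
        _ = m := by simp [hmdef]
    simp only [havg, ← sum_div]
    rw [div_div, ← mul_div_assoc, div_le_one (by positivity)]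
    calc (s : ℝ) * ∑ a, ∑ b, φ a b ≤ s * m := mul_le_mul_of_nonneg_left h (by positivity)
      _ ≤ m * m := mul_le_mul_of_nonneg_right hs2 hm.le
  have hle1 : ∀ φ : B → ℝ, (∀ a, φ a ≤ 1) → 𝔼 a, φ a ≤ 1 := fun φ hφ =>
    expect_le univ_nonempty fun a _ => hφ a
  have hgE : 𝔼 u : Fin s → B, 𝔼 v : Fin s → B,
      ∑ i, ∑ i', ∑ j, ∑ j', g (u i) (u i') (v j) (v j') ≤ 4 * (s : ℝ) ^ 2 := by
    refine (expect_expect_sum_le g hg0).trans ?_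
    have e3 : (s : ℝ) * 𝔼 a, 𝔼 a', 𝔼 b, g a a' b b ≤ 1 := by
      refine hsub _ fun a a' => ?_
      split_ifs with h
      · exact hle1 _ fun b => hg1 _ _ _ _
      · refine (expect_eq_zero fun b _ => ?_).le
        simp only [hg]
        refine if_neg fun hb => h ?_
        exact Subtype.ext (sub_left_injective hb.2)
    have e4 : (s : ℝ) * 𝔼 a, 𝔼 b, 𝔼 b', g a a b b' ≤ 1 := by
      have : 𝔼 a, 𝔼 b, 𝔼 b', g a a b b' = 𝔼 b, 𝔼 b', 𝔼 a, g a a b b' := by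
        rw [expect_comm]
        exact expect_congr rfl fun b _ => expect_comm _ _ _
      rw [this]
      refine hsub _ fun b b' => ?_
      split_ifs with h
      · exact hle1 _ fun a => hg1 _ _ _ _
      · refine (expect_eq_zero fun a _ => ?_).le
        simp only [hg]
        refine if_neg fun hb => h ?_
        exact Subtype.ext (sub_right_injective hb.2)
    have e5 : 𝔼 a, 𝔼 b, g a a b b ≤ 1 := hle1 _ fun a => hle1 _ fun b => hg1 _ _ _ _
    have hs0 : (0 : ℝ) ≤ (s : ℝ) := Nat.cast_nonneg s
    have hs20 : (0 : ℝ) ≤ (s : ℝ) ^ 2 := by positivity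
    have f1 := mul_le_mul_of_nonneg_left (add_le_add hE4 e3) hs20
    have f3 := mul_le_mul_of_nonneg_left e4 hs20
    have f4 := mul_le_mul_of_nonneg_left e5 hs20
    linarith
  have hfE : (s : ℝ) ^ 2 / 2 ≤ 𝔼 u : Fin s → B, 𝔼 v : Fin s → B,
      ∑ i, ∑ j, if (u i : G) - v j ∈ U then (1 : ℝ) else 0 := by
    rw [expect_expect_sum_eq fun a b : B => if (a : G) - b ∈ U then (1 : ℝ) else 0]
    have := mul_le_mul_of_nonneg_left hf (by positivity : (0 : ℝ) ≤ (s : ℝ) ^ 2)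
    linarith
  have hfinal : 𝔼 _u : Fin s → B, 𝔼 _v : Fin s → B, (s : ℝ) ^ 2 / 16
      ≤ 𝔼 u : Fin s → B, 𝔼 v : Fin s → B,
        (((univ : Finset (Fin s × Fin s)).image fun ij => (u ij.1 : G) - v ij.2).card : ℝ) := by
    calc 𝔼 _u : Fin s → B, 𝔼 _v : Fin s → B, (s : ℝ) ^ 2 / 16
        = (s : ℝ) ^ 2 / 2 / 4 - 4 * (s : ℝ) ^ 2 / 64 := by
          rw [Fintype.expect_const, Fintype.expect_const]; ring
      _ ≤ (𝔼 u : Fin s → B, 𝔼 v : Fin s → B,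
            ∑ i, ∑ j, if (u i : G) - v j ∈ U then (1 : ℝ) else 0) / 4
          - (𝔼 u : Fin s → B, 𝔼 v : Fin s → B,
            ∑ i, ∑ i', ∑ j, ∑ j', g (u i) (u i') (v j) (v j')) / 64 := by linarith
      _ = 𝔼 u : Fin s → B, 𝔼 v : Fin s → B,
            ((∑ i, ∑ j, if (u i : G) - v j ∈ U then (1 : ℝ) else 0) / 4
              - (∑ i, ∑ i', ∑ j, ∑ j', g (u i) (u i') (v j) (v j')) / 64) := by
          simp only [expect_sub_distrib, ← expect_div]
      _ ≤ _ := expect_le_expect fun u _ => expect_le_expect fun v _ =>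
          card_image_sub_ge U (fun i => (u i : G)) (fun i => (v i : G))
  obtain ⟨u, -, hu⟩ := exists_le_of_expect_le_expect univ_nonempty hfinal
  obtain ⟨v, -, hv⟩ := exists_le_of_expect_le_expect univ_nonempty hu
  exact ⟨fun i => u i, fun i => v i, fun i => (u i).2, fun i => (v i).2, hv⟩

end RandomSubset

section Fingerprint

theorem sum_union_le {α : Type*} [DecidableEq α] (s t : Finset α) {f : α → ℝ}
    (hf : ∀ a, 0 ≤ f a) : ∑ a ∈ s ∪ t, f a ≤ ∑ a ∈ s, f a + ∑ a ∈ t, f a := by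
  rw [← sum_union_inter]
  exact le_add_of_nonneg_right (sum_nonneg fun a _ => hf a)

theorem sum_biUnion_le {ι α : Type*} [DecidableEq α] (s : Finset ι) (t : ι → Finset α) {f : α → ℝ}
    (hf : ∀ a, 0 ≤ f a) : ∑ a ∈ s.biUnion t, f a ≤ ∑ i ∈ s, ∑ a ∈ t i, f a := by
  induction s using Finset.induction_on with
  | empty => simp
  | insert i s hi ih =>
    rw [biUnion_insert, sum_insert hi]
    exact (sum_union_le _ _ hf).trans (by gcongr)

theorem sum_exp_filter_card_le {α β : Type*} [Fintype α] [DecidableEq β] {p : ℝ} (hp : 0 ≤ p)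
    (f : α → Finset β)
    (d : ℝ) :
    ∑ D ∈ (univ.image f).filter (fun D => d ≤ (D.card : ℝ)),
        Real.exp (-(p * (((D.card : ℝ) - 1) / 2)))
      ≤ Fintype.card α * Real.exp (-(p * ((d - 1) / 2))) := by
  calc ∑ D ∈ (univ.image f).filter (fun D => d ≤ (D.card : ℝ)),
        Real.exp (-(p * (((D.card : ℝ) - 1) / 2)))
      ≤ ∑ D ∈ (univ.image f).filter (fun D => d ≤ (D.card : ℝ)),
        Real.exp (-(p * ((d - 1) / 2))) := by
        refine sum_le_sum fun D hD => Real.exp_le_exp.2 (neg_le_neg ?_)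
        have := (mem_filter.1 hD).2
        gcongr
    _ ≤ _ := by
        rw [sum_const, nsmul_eq_mul]
        gcongr
        exact_mod_cast (card_filter_le _ _).trans card_image_le

variable {G : Type} [AddCommGroup G] [Fintype G] [DecidableEq G]

/-- Every large set has a difference set containing a large member of a small family of sets. -/
theorem exists_fingerprint_family {p M : ℝ} (hp : 0 ≤ p) (hM : 0 < M) (J : ℕ) (S : ℕ → ℕ)
    (hS : ∀ j ≤ J, 16 * ((2 : ℝ) ^ j) ^ 2 * Real.log (2 * Fintype.card G) < S j) {s : ℕ}
    (hs1 : (s : ℝ) ^ 2 ≤ 2 ^ J * M) (hs2 : (s : ℝ) ≤ M) :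
    ∃ 𝓓 : Finset (Finset G),
      (∀ B : Finset G, M < (B.card : ℝ) → ∃ D ∈ 𝓓, ∀ x ∈ D, ∃ b ∈ B, ∃ b' ∈ B, b - b' = x) ∧
      ∑ D ∈ 𝓓, Real.exp (-(p * (((D.card : ℝ) - 1) / 2)))
        ≤ ∑ j ∈ range (J + 1), (Fintype.card G : ℝ) ^ S j
            * Real.exp (-(p * ((M * 2 ^ j / (4 * (J + 1)) - 1) / 2)))
          + (Fintype.card G : ℝ) ^ (2 * s) * Real.exp (-(p * (((s : ℝ) ^ 2 / 16 - 1) / 2))) := by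
  set F : ∀ j : ℕ, (Fin (S j) → AddChar G ℂ) → Finset G := fun j c =>
    {x | (S j : ℝ) / (2 * 2 ^ j) ≤ ∑ i, (c i x).re} with hF
  set E : (Fin s → G) × (Fin s → G) → Finset G := fun uv =>
    (univ : Finset (Fin s × Fin s)).image fun ij => uv.1 ij.1 - uv.2 ij.2 with hE
  set 𝓕 : ℕ → Finset (Finset G) := fun j =>
    (univ.image (F j)).filter (fun D => M * 2 ^ j / (4 * (J + 1)) ≤ (D.card : ℝ)) with h𝓕
  set 𝓔 : Finset (Finset G) :=
    (univ.image E).filter (fun D => (s : ℝ) ^ 2 / 16 ≤ (D.card : ℝ)) with h𝓔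
  refine ⟨(range (J + 1)).biUnion 𝓕 ∪ 𝓔, fun B hB => ?_, ?_⟩
  · have hB0 : B.Nonempty := by
      rw [← card_pos]
      exact_mod_cast hM.trans hB
    have hm : (0 : ℝ) < B.card := hM.trans hB
    rcases exists_dyadic_popular hB0 J with h | ⟨j, hj, h⟩
    · obtain ⟨u, v, hu, hv, huv⟩ := exists_sample_card_image_sub_ge hB0 (by positivity) h.le
        (hs1.trans (by gcongr)) (hs2.trans hB.le)
      refine ⟨E (u, v), mem_union_right _ (mem_filter.2 ⟨mem_image_of_mem _ (mem_univ _), huv⟩),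
        fun x hx => ?_⟩
      obtain ⟨ij, -, rfl⟩ := mem_image.1 hx
      exact ⟨_, hu ij.1, _, hv ij.2, rfl⟩
    · obtain ⟨c, hc⟩ := exists_addChar_approx_diffCount hB0 (one_le_pow₀ one_le_two) (hS j hj)
      have hsub : ({x | (B.card : ℝ) ≤ 2 ^ j * diffCount B x} : Finset G) ⊆ F j c := by
        intro x hx
        have hx : (B.card : ℝ) ≤ 2 ^ j * diffCount B x := (mem_filter.1 hx).2
        refine mem_filter.2 ⟨mem_univ _, ?_⟩
        have h1 := (abs_lt.1 (hc x)).1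
        have h2 : (S j : ℝ) * (1 / 2 ^ j) ≤ S j * (diffCount B x / B.card) := by
          refine mul_le_mul_of_nonneg_left ?_ (by positivity)
          rw [div_le_div_iff₀ (by positivity) hm]
          linarith
        have h3 : (S j : ℝ) * (1 / 2 ^ j) = S j / (2 * 2 ^ j) + S j / (2 * 2 ^ j) := by
          field_simp; norm_num
        linarith
      refine ⟨F j c, mem_union_left _ (mem_biUnion.2 ⟨j, mem_range.2 (Nat.lt_succ_of_le hj),
        mem_filter.2 ⟨mem_image_of_mem _ (mem_univ _), ?_⟩⟩), fun x hx => ?_⟩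
      · calc M * 2 ^ j / (4 * (J + 1)) ≤ (B.card : ℝ) * 2 ^ j / (4 * (J + 1)) := by gcongr
          _ ≤ _ := h
          _ ≤ _ := by exact_mod_cast card_le_card hsub
      · by_contra hx0
        have h1 := (abs_lt.1 (hc x)).2
        rw [diffCount_eq_zero hx0, zero_div, mul_zero, sub_zero] at h1
        exact absurd (mem_filter.1 hx).2 (not_le.2 h1)
  · have hpos : ∀ D : Finset G, 0 ≤ Real.exp (-(p * (((D.card : ℝ) - 1) / 2))) :=
      fun D => (Real.exp_pos _).le
    refine (sum_union_le _ _ hpos).trans (add_le_add ?_ ?_)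
    · refine (sum_biUnion_le _ _ hpos).trans (sum_le_sum fun j _ => ?_)
      refine (sum_exp_filter_card_le hp (F j) _).trans_eq ?_
      rw [Fintype.card_fun, Fintype.card_fin, AddChar.card_eq, Nat.cast_pow]
    · refine (sum_exp_filter_card_le hp E _).trans_eq ?_
      rw [Fintype.card_prod, Fintype.card_fun, Fintype.card_fin, two_mul, pow_add, Nat.cast_mul,
        Nat.cast_pow]

end Fingerprint

section Parameters

theorem pow_le_const_mul_pow {w : ℝ} (hw : 9 / 10 ≤ w) (a b : ℕ) (hab : a ≤ b) :
    (9 / 10 : ℝ) ^ (b - a) * w ^ a ≤ w ^ b := by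
  have h0 : (0 : ℝ) < w := lt_of_lt_of_le (by norm_num) hw
  calc (9 / 10 : ℝ) ^ (b - a) * w ^ a ≤ w ^ (b - a) * w ^ a := by gcongr
    _ = w ^ b := by rw [← pow_add, Nat.sub_add_cancel hab]

theorem le_of_pow_four_eq_log {n : ℕ} (hn : 2 ≤ n) {w : ℝ} (hw0 : 0 < w)
    (hw : w ^ 4 = Real.log n) : 9 / 10 ≤ w := by
  have h2 : Real.log 2 ≤ Real.log n := Real.log_le_log (by norm_num) (by exact_mod_cast hn)
  have h3 := Real.log_two_gt_d9
  refine le_of_pow_le_pow_left₀ (n := 4) (by norm_num) hw0.le ?_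
  norm_num at h3 ⊢
  linarith

/-- The contribution of the sets with many popular differences to the union bound. -/
theorem sum_range_exp_le {p q w : ℝ} {n : ℕ} (hn : 2 ≤ n) (hp1 : p ≤ 1 / 2)
    (hpq : p * q ^ 2 = 1) (hq : 1 ≤ q) (hw0 : 0 < w) (hw : w ^ 4 = Real.log n) {J : ℕ}
    (hJ : (2 : ℝ) ^ J ≤ 2 * q) (hJ' : (J + 1 : ℝ) ≤ 5 * w ^ 4) (S : ℕ → ℕ)
    (hS : ∀ j ≤ J, (S j : ℝ) ≤ 34 * ((2 : ℝ) ^ j) ^ 2 * w ^ 4) :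
    ∑ j ∈ range (J + 1), (n : ℝ) ^ S j
        * Real.exp (-(p * ((10 ^ 6 * q ^ 3 * w ^ 19 * 2 ^ j / (4 * (J + 1)) - 1) / 2)))
      ≤ Real.exp (-(q * w ^ 11)) / 2 := by
  have hw9 := le_of_pow_four_eq_log hn hw0 hw
  have a1 := pow_le_const_mul_pow hw9 0 15 (by norm_num)
  have a2 := pow_le_const_mul_pow hw9 4 15 (by norm_num)
  have a3 := pow_le_const_mul_pow hw9 8 15 (by norm_num)
  have a4 := pow_le_const_mul_pow hw9 11 15 (by norm_num)
  norm_num at a1 a2 a3 a4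
  set X := q * w ^ 15 with hX
  have hX1 : 1 ≤ 5 * X := by nlinarith [pow_pos hw0 15]
  have hn0 : (0 : ℝ) < n := by positivity
  have hterm : ∀ j ∈ range (J + 1), (n : ℝ) ^ S j
        * Real.exp (-(p * ((10 ^ 6 * q ^ 3 * w ^ 19 * 2 ^ j / (4 * (J + 1)) - 1) / 2)))
      ≤ Real.exp (-(24000 * X)) := by
    intro j hj
    have hj : j ≤ J := Nat.lt_succ_iff.1 (mem_range.1 hj)
    have h2j : (2 : ℝ) ^ j ≤ 2 * q := (pow_le_pow_right₀ (by norm_num) hj).trans hJ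
    have h2j1 : (1 : ℝ) ≤ 2 ^ j := one_le_pow₀ (by norm_num)
    have e1 : (n : ℝ) ^ S j = Real.exp (S j * w ^ 4) := by
      rw [hw, Real.exp_nat_mul, Real.exp_log hn0]
    rw [e1, ← Real.exp_add, Real.exp_le_exp]
    have e2 : (S j : ℝ) * w ^ 4 ≤ 143 * (X * 2 ^ j) := by
      calc (S j : ℝ) * w ^ 4 ≤ (34 * ((2 : ℝ) ^ j) ^ 2 * w ^ 4) * w ^ 4 := by
            gcongr; exact hS j hj
        _ = 34 * 2 ^ j * 2 ^ j * w ^ 8 := by ring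
        _ ≤ 34 * (2 * q) * 2 ^ j * w ^ 8 := by gcongr
        _ = 68 * q * 2 ^ j * w ^ 8 := by ring
        _ ≤ 68 * q * 2 ^ j * (10000000 / 4782969 * w ^ 15) := by gcongr; linarith
        _ = 68 * (10000000 / 4782969) * (X * 2 ^ j) := by rw [hX]; ring
        _ ≤ _ := by gcongr; norm_num
    have e3 : 25000 * (X * 2 ^ j)
        ≤ p * (10 ^ 6 * q ^ 3 * w ^ 19 * 2 ^ j / (4 * (J + 1))) / 2 := by
      rw [mul_div_assoc', div_div, le_div_iff₀ (by positivity)]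
      calc 25000 * (X * 2 ^ j) * (4 * (J + 1) * 2)
          = 200000 * X * 2 ^ j * (J + 1) := by ring
        _ ≤ 200000 * X * 2 ^ j * (5 * w ^ 4) := by gcongr
        _ = p * q ^ 2 * (10 ^ 6 * q * w ^ 19 * 2 ^ j) := by rw [hpq, hX]; ring
        _ = _ := by ring
    have e4 : X ≤ X * 2 ^ j := le_mul_of_one_le_right (by positivity) h2j1
    nlinarith
  refine (sum_le_card_nsmul _ _ _ hterm).trans ?_
  rw [card_range, nsmul_eq_mul, Nat.cast_succ]
  have hJ2 : (J + 1 : ℝ) ≤ Real.exp (16 * X) := by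
    refine (by linarith [Real.add_one_le_exp (J + 1 : ℝ)] : (J + 1 : ℝ) ≤ Real.exp (J + 1)).trans
      (Real.exp_le_exp.2 (hJ'.trans ?_))
    nlinarith [pow_pos hw0 15]
  have h2 : Real.exp 1 * (Real.exp (-(q * w ^ 11)) / 2) ≥ Real.exp (-(q * w ^ 11)) := by
    nlinarith [Real.add_one_le_exp (1 : ℝ), Real.exp_pos (-(q * w ^ 11))]
  have h3 : (J + 1 : ℝ) * Real.exp (-(24000 * X)) ≤ Real.exp (-1) * Real.exp (-(q * w ^ 11)) := by
    calc (J + 1 : ℝ) * Real.exp (-(24000 * X)) ≤ Real.exp (16 * X) * Real.exp (-(24000 * X)) := by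
          gcongr
      _ ≤ _ := by
          rw [← Real.exp_add, ← Real.exp_add, Real.exp_le_exp]
          have : q * w ^ 11 ≤ q * (10000 / 6561 * w ^ 15) := by gcongr; linarith
          nlinarith
  refine h3.trans ?_
  rw [Real.exp_neg, inv_mul_le_iff₀ (Real.exp_pos _)]
  exact h2

/-- The contribution of the sets with few popular differences to the union bound. -/
theorem pow_mul_exp_le {p q w : ℝ} {n : ℕ} (hn : 2 ≤ n) (hp1 : p ≤ 1 / 2)
    (hpq : p * q ^ 2 = 1) (hq : 1 ≤ q) (hw0 : 0 < w) (hw : w ^ 4 = Real.log n) {s : ℕ}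
    (hs : 300 * q ^ 2 * w ^ 8 ≤ s) (hs' : (s : ℝ) ≤ 600 * q ^ 2 * w ^ 8) :
    (n : ℝ) ^ (2 * s) * Real.exp (-(p * (((s : ℝ) ^ 2 / 16 - 1) / 2)))
      ≤ Real.exp (-(q * w ^ 11)) / 2 := by
  have hw9 := le_of_pow_four_eq_log hn hw0 hw
  have a1 := pow_le_const_mul_pow hw9 0 16 (by norm_num)
  have a2 := pow_le_const_mul_pow hw9 12 16 (by norm_num)
  have a3 := pow_le_const_mul_pow hw9 11 16 (by norm_num)
  norm_num at a1 a2 a3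
  have hn0 : (0 : ℝ) < n := by positivity
  set X := q ^ 2 * w ^ 16 with hX
  have hq2 : (1 : ℝ) ≤ q ^ 2 := one_le_pow₀ hq
  have hX1 : 1 ≤ 6 * X := by nlinarith [pow_pos hw0 16]
  have e1 : (n : ℝ) ^ (2 * s) = Real.exp (2 * (s * w ^ 4)) := by
    rw [show 2 * ((s : ℝ) * w ^ 4) = ((2 * s : ℕ) : ℝ) * Real.log n by rw [hw]; push_cast; ring,
      Real.exp_nat_mul, Real.exp_log hn0]
  have e2 : 2 * ((s : ℝ) * w ^ 4) ≤ 1900 * X := by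
    calc 2 * ((s : ℝ) * w ^ 4) ≤ 2 * (600 * q ^ 2 * w ^ 8 * w ^ 4) := by gcongr
      _ = 1200 * q ^ 2 * w ^ 12 := by ring
      _ ≤ 1200 * q ^ 2 * (10000 / 6561 * w ^ 16) := by gcongr; linarith
      _ = 1200 * (10000 / 6561) * X := by rw [hX]; ring
      _ ≤ _ := by gcongr; norm_num
  have e3 : 2800 * X ≤ p * (s : ℝ) ^ 2 / 32 := by
    have hp0 : 0 < p := by
      by_contra h
      nlinarith
    calc 2800 * X ≤ 90000 / 32 * X := by gcongr; norm_num
      _ = (p * q ^ 2) * (90000 * q ^ 2 * w ^ 16) / 32 := by rw [hpq, hX]; ring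
      _ = p * (300 * q ^ 2 * w ^ 8) ^ 2 / 32 := by ring
      _ ≤ _ := by gcongr
  have e4 : q * w ^ 11 ≤ 2 * X := by
    calc q * w ^ 11 ≤ q ^ 2 * (100000 / 59049 * w ^ 16) := by
          gcongr
          · nlinarith
          · linarith
      _ ≤ _ := by rw [hX]; nlinarith [pow_pos hw0 16]
  have h2 : Real.exp 1 * (Real.exp (-(q * w ^ 11)) / 2) ≥ Real.exp (-(q * w ^ 11)) := by
    nlinarith [Real.add_one_le_exp (1 : ℝ), Real.exp_pos (-(q * w ^ 11))]
  have h3 : (n : ℝ) ^ (2 * s) * Real.exp (-(p * (((s : ℝ) ^ 2 / 16 - 1) / 2)))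
      ≤ Real.exp (-1) * Real.exp (-(q * w ^ 11)) := by
    rw [e1, ← Real.exp_add, ← Real.exp_add, Real.exp_le_exp]
    nlinarith
  refine h3.trans ?_
  rw [Real.exp_neg, inv_mul_le_iff₀ (Real.exp_pos _)]
  exact h2

variable {G : Type} [AddCommGroup G] [Fintype G] [DecidableEq G]

theorem one_sub_exp_le_prob_indep (hn : 2 ≤ Fintype.card G) {p q w : ℝ} (hp0 : 0 < p)
    (hp1 : p ≤ 1 / 2) (hpq : p * q ^ 2 = 1) (hq0 : 0 < q) (hw0 : 0 < w)
    (hw : w ^ 4 = Real.log (Fintype.card G)) :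
    let classes : Finset (Finset G) :=
      ((univ : Finset G).erase 0).image fun x => ({x, -x} : Finset G)
    1 - Real.exp (-(q * w ^ 11)) ≤ ∑ T ∈ classes.powerset,
      (if ∀ B : Finset G, (∀ b ∈ B, ∀ b' ∈ B, b ≠ b' → b - b' ∉ T.sup id) →
          (B.card : ℝ) ≤ 10 ^ 6 * q ^ 3 * w ^ 19
        then p ^ T.card * (1 - p) ^ (classes.card - T.card) else 0) := by
  intro classes
  have hw9 := le_of_pow_four_eq_log hn hw0 hw
  have hq : 1 ≤ q := by
    by_contra h
    nlinarith
  have hn0 : (0 : ℝ) < Fintype.card G := by positivity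
  rcases le_or_gt (Fintype.card G : ℝ) (10 ^ 6 * q ^ 3 * w ^ 19) with hM | hM
  · refine le_trans ?_ (one_sub_sum_le_prob_indep hp0 hp1 ∅ fun B hB => ?_)
    · rw [sum_empty]
      linarith [Real.exp_pos (-(q * w ^ 11))]
    · exact absurd ((Nat.cast_le.2 (card_le_univ B)).trans hM) (not_le.2 hB)
  obtain ⟨k, hk1, hk2⟩ := exists_nat_pow_near hq (one_lt_two : (1 : ℝ) < 2)
  have a1 := pow_le_const_mul_pow hw9 0 19 (by norm_num)
  have a2 := pow_le_const_mul_pow hw9 8 19 (by norm_num)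
  have a3 := pow_le_const_mul_pow hw9 16 19 (by norm_num)
  have a4 := pow_le_const_mul_pow hw9 0 4 (by norm_num)
  have a5 := pow_le_const_mul_pow hw9 0 8 (by norm_num)
  norm_num at a1 a2 a3 a4 a5
  have hqn : q ≤ Fintype.card G := by
    refine le_trans ?_ hM.le
    have h1 : q ≤ q ^ 3 := le_self_pow₀ hq (by norm_num)
    nlinarith [pow_pos hq0 3]
  have hJ' : ((k + 1 : ℕ) + 1 : ℝ) ≤ 5 * w ^ 4 := by
    have h1 : (k : ℝ) * Real.log 2 ≤ w ^ 4 := by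
      rw [hw, ← Real.log_pow]
      exact Real.log_le_log (by positivity) (hk1.trans hqn)
    have h2 := Real.log_two_gt_d9
    push_cast
    nlinarith [Nat.cast_nonneg (α := ℝ) k]
  set S : ℕ → ℕ := fun j => ⌊32 * ((2 : ℝ) ^ j) ^ 2 * w ^ 4⌋₊ + 1 with hS
  have hS1 : ∀ j, 32 * ((2 : ℝ) ^ j) ^ 2 * w ^ 4 < S j := fun j => by
    rw [hS]; push_cast; exact Nat.lt_floor_add_one _
  have hS2 : ∀ j, (S j : ℝ) ≤ 34 * ((2 : ℝ) ^ j) ^ 2 * w ^ 4 := fun j => by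
    have h1 := Nat.floor_le (by positivity : 0 ≤ 32 * ((2 : ℝ) ^ j) ^ 2 * w ^ 4)
    have h2 : (1 : ℝ) ≤ ((2 : ℝ) ^ j) ^ 2 := one_le_pow₀ (one_le_pow₀ (by norm_num))
    rw [hS]; push_cast
    nlinarith
  have hlog : Real.log (2 * Fintype.card G) ≤ 2 * w ^ 4 := by
    rw [Real.log_mul (by norm_num) hn0.ne', hw]
    have : Real.log 2 ≤ Real.log (Fintype.card G) :=
      Real.log_le_log (by norm_num) (by exact_mod_cast hn)
    linarith
  set s : ℕ := ⌈300 * q ^ 2 * w ^ 8⌉₊ with hs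
  have hs1 : 300 * q ^ 2 * w ^ 8 ≤ s := Nat.le_ceil _
  have hq2 : (1 : ℝ) ≤ q ^ 2 := one_le_pow₀ hq
  have hs2 : (s : ℝ) ≤ 600 * q ^ 2 * w ^ 8 := by
    have h1 := Nat.ceil_lt_add_one (by positivity : 0 ≤ 300 * q ^ 2 * w ^ 8)
    nlinarith
  have hsM1 : (s : ℝ) ^ 2 ≤ 2 ^ (k + 1) * (10 ^ 6 * q ^ 3 * w ^ 19) := by
    calc (s : ℝ) ^ 2 ≤ (600 * q ^ 2 * w ^ 8) ^ 2 := by gcongr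
      _ = q * q ^ 3 * (360000 * w ^ 16) := by ring
      _ ≤ 2 ^ (k + 1) * q ^ 3 * (10 ^ 6 * w ^ 19) := by
          refine mul_le_mul (mul_le_mul_of_nonneg_right hk2.le (by positivity)) ?_ (by positivity)
            (by positivity)
          linarith
      _ = _ := by ring
  have hsM2 : (s : ℝ) ≤ 10 ^ 6 * q ^ 3 * w ^ 19 := by
    calc (s : ℝ) ≤ 600 * q ^ 2 * w ^ 8 := hs2
      _ = q ^ 2 * (600 * w ^ 8) := by ring
      _ ≤ q ^ 3 * (10 ^ 6 * w ^ 19) := by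
          refine mul_le_mul (pow_le_pow_right₀ hq (by norm_num)) ?_ (by positivity) (by positivity)
          linarith
      _ = _ := by ring
  obtain ⟨𝓓, h1, h2⟩ := exists_fingerprint_family (G := G) (M := 10 ^ 6 * q ^ 3 * w ^ 19) hp0.le
    (by positivity) (k + 1) S
    (fun j _ => lt_of_le_of_lt
      ((mul_le_mul_of_nonneg_left hlog (by positivity)).trans_eq (by ring)) (hS1 j))
    hsM1 hsM2
  refine le_trans ?_ (one_sub_sum_le_prob_indep hp0 hp1 𝓓 h1)
  have h3 := sum_range_exp_le hn hp1 hpq hq hw0 hw (J := k + 1)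
    (by rw [pow_succ]; linarith) hJ' S fun j _ => hS2 j
  have h4 := pow_mul_exp_le hn hp1 hpq hq hw0 hw hs1 hs2
  linarith

end Parameters

/-- whp bound on the independence number of the random Cayley graph `G(p)`.
The random symmetric generating set is modeled by choosing a subset `T` of the set of
equivalence classes `{x, -x}` (over nonzero `x`), each class included independently with
probability `p`; the generating set is then `T.sup id`, the union of the chosen classes. -/
theorem stmt0 :
    ∃ ξ c : ℝ, 0 < ξ ∧ 0 < c ∧
      ∀ (G : Type) [AddCommGroup G] [Fintype G] [DecidableEq G],
        2 ≤ Fintype.card G →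
        ∀ p : ℝ, 0 < p → p ≤ 1 / 2 →
          let n : ℕ := Fintype.card G
          let classes : Finset (Finset G) :=
            ((Finset.univ : Finset G).erase 0).image fun x => ({x, -x} : Finset G)
          (∑ T ∈ classes.powerset,
              (if ∀ B : Finset G,
                    (∀ b ∈ B, ∀ b' ∈ B, b ≠ b' → b - b' ∉ T.sup id) →
                    (B.card : ℝ) ≤ ξ * p ^ (-(3 : ℝ) / 2) * Real.log n ^ ((19 : ℝ) / 4)
                then p ^ T.card * (1 - p) ^ (classes.card - T.card) else 0))
            ≥ 1 - Real.exp (-c * p ^ (-(1 : ℝ) / 2) * Real.log n ^ ((11 : ℝ) / 4)) := by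
  refine ⟨10 ^ 6, 1, by norm_num, one_pos, ?_⟩
  intro G _ _ _ hn p hp0 hp1 n classes
  have hlog : 0 ≤ Real.log n := Real.log_natCast_nonneg n
  have hlog0 : 0 < Real.log n := Real.log_pos (by exact_mod_cast hn)
  have h := one_sub_exp_le_prob_indep hn hp0 hp1 (q := p ^ (-(1 : ℝ) / 2))
    (w := Real.log n ^ ((1 : ℝ) / 4))
    (by
      rw [← Real.rpow_mul_natCast hp0.le]
      norm_num
      rw [Real.rpow_neg_one, mul_inv_cancel₀ hp0.ne'])
    (by positivity) (by positivity)
    (by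
      rw [← Real.rpow_mul_natCast hlog]
      norm_num
      rfl)
  have e1 : (p ^ (-(1 : ℝ) / 2)) ^ 3 = p ^ (-(3 : ℝ) / 2) := by
    rw [← Real.rpow_mul_natCast hp0.le]; norm_num
  have e2 : (Real.log n ^ ((1 : ℝ) / 4)) ^ 19 = Real.log n ^ ((19 : ℝ) / 4) := by
    rw [← Real.rpow_mul_natCast hlog]; norm_num
  have e3 : (Real.log n ^ ((1 : ℝ) / 4)) ^ 11 = Real.log n ^ ((11 : ℝ) / 4) := by
    rw [← Real.rpow_mul_natCast hlog]; norm_num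
  rw [e1, e2, e3] at h
  rw [ge_iff_le, neg_one_mul, neg_mul]
  exact h
end

section
/- There exist absolute constants ξ, c > 0 such that the following holds. Let G be a finite abelian group of order n ≥ 2 and let p ∈ (0, 1/2]. Let S be a random subset of G obtained by including each element of G independently with probability p. Then with probability at least 1 − exp(−c·p^{−1/2}·(log n)^{11/4}), every subset B ⊆ G with (B + B) ∩ S = ∅ has size |B| ≤ ξ·p^{−3/2}·(log n)^{19/4}. -/
open scoped Pointwise Classical
open Finset

section Bernoulli

variable {α : Type*}

/-- Expectation of `f S`, where `S` is a random subset of `U` including each element independently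
with probability `p`. -/
noncomputable def bernoulliExp (p : ℝ) (U : Finset α) (f : Finset α → ℝ) : ℝ :=
  ∑ S ∈ U.powerset, p ^ S.card * (1 - p) ^ (U.card - S.card) * f S

lemma bernoulliExp_empty (p : ℝ) (f : Finset α → ℝ) : bernoulliExp p ∅ f = f ∅ := by
  simp [bernoulliExp]

lemma bernoulliExp_mono {p : ℝ} (hp0 : 0 ≤ p) (hp1 : p ≤ 1) {U : Finset α}
    {f g : Finset α → ℝ} (h : ∀ S ⊆ U, f S ≤ g S) : bernoulliExp p U f ≤ bernoulliExp p U g := by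
  refine Finset.sum_le_sum fun S hS => ?_
  have : 0 ≤ 1 - p := by linarith
  exact mul_le_mul_of_nonneg_left (h S (Finset.mem_powerset.1 hS)) (by positivity)

lemma bernoulliExp_congr {p : ℝ} {U : Finset α}
    {f g : Finset α → ℝ} (h : ∀ S ⊆ U, f S = g S) : bernoulliExp p U f = bernoulliExp p U g :=
  Finset.sum_congr rfl fun S hS => by rw [h S (Finset.mem_powerset.1 hS)]

lemma bernoulliExp_add (p : ℝ) (U : Finset α) (f g : Finset α → ℝ) :
    bernoulliExp p U (fun S => f S + g S) = bernoulliExp p U f + bernoulliExp p U g := by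
  simp only [bernoulliExp, mul_add, Finset.sum_add_distrib]

lemma bernoulliExp_mul_left (p : ℝ) (U : Finset α) (c : ℝ) (f : Finset α → ℝ) :
    bernoulliExp p U (fun S => c * f S) = c * bernoulliExp p U f := by
  simp only [bernoulliExp, Finset.mul_sum]
  exact Finset.sum_congr rfl fun S _ => by ring

lemma bernoulliExp_sum {ι : Type*} (p : ℝ) (U : Finset α) (I : Finset ι)
    (f : ι → Finset α → ℝ) :
    bernoulliExp p U (fun S => ∑ i ∈ I, f i S) = ∑ i ∈ I, bernoulliExp p U (f i) := by
  simp only [bernoulliExp, Finset.mul_sum]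
  exact Finset.sum_comm

variable [DecidableEq α]

lemma bernoulliExp_insert (p : ℝ) {x : α} {U : Finset α} (hx : x ∉ U) (f : Finset α → ℝ) :
    bernoulliExp p (insert x U) f =
      (1 - p) * bernoulliExp p U f + p * bernoulliExp p U (fun S => f (insert x S)) := by
  unfold bernoulliExp
  rw [Finset.sum_powerset_insert hx, Finset.mul_sum, Finset.mul_sum]
  congr 1
  · refine Finset.sum_congr rfl fun S hS => ?_
    have hS' := Finset.card_le_card (Finset.mem_powerset.1 hS)
    rw [Finset.card_insert_of_notMem hx, Nat.succ_sub hS', pow_succ]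
    ring
  · refine Finset.sum_congr rfl fun S hS => ?_
    have hxS : x ∉ S := fun h => hx (Finset.mem_powerset.1 hS h)
    rw [Finset.card_insert_of_notMem hx, Finset.card_insert_of_notMem hxS,
      Nat.add_sub_add_right, pow_succ]
    ring

lemma bernoulliExp_prod (p : ℝ) (U : Finset α) (A B : α → ℝ) :
    bernoulliExp p U (fun S => ∏ s ∈ U, if s ∈ S then A s else B s) =
      ∏ s ∈ U, (p * A s + (1 - p) * B s) := by
  rw [Finset.prod_add]
  refine Finset.sum_congr rfl fun S hS => ?_
  have hS' := Finset.mem_powerset.1 hS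
  rw [Finset.prod_mul_distrib, Finset.prod_mul_distrib, Finset.prod_const, Finset.prod_const,
    Finset.card_sdiff_of_subset hS']
  dsimp only
  rw [← Finset.prod_sdiff hS',
    Finset.prod_congr (s₁ := U \ S) rfl fun s hs => if_neg (Finset.mem_sdiff.1 hs).2,
    Finset.prod_congr (s₁ := S) rfl fun s hs => if_pos hs]
  ring

lemma bernoulliExp_const (p : ℝ) (U : Finset α) (c : ℝ) :
    bernoulliExp p U (fun _ => c) = c := by
  have h := bernoulliExp_prod p U (fun _ => 1) (fun _ => 1)
  simp at h
  have := bernoulliExp_mul_left p U c (fun _ => 1)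
  simpa [h] using this

lemma bernoulliExp_pos {p : ℝ} (hp0 : 0 ≤ p) (hp1 : p ≤ 1) (U : Finset α)
    {f : Finset α → ℝ} (h : ∀ S, 0 < f S) : 0 < bernoulliExp p U f := by
  obtain ⟨S₀, -, hS₀⟩ := Finset.exists_min_image U.powerset f ⟨∅, by simp⟩
  calc 0 < f S₀ := h S₀
    _ = bernoulliExp p U (fun _ => f S₀) := (bernoulliExp_const _ _ _).symm
    _ ≤ _ := bernoulliExp_mono hp0 hp1 fun S hS => hS₀ S (Finset.mem_powerset.2 hS)

lemma exists_interpolation {p r : ℝ} (hp0 : 0 < p) (hp : p ≤ 1 / 2) (hr0 : 0 < r) (hr1 : r < 1) :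
    ∃ θ φ : ℝ, 0 ≤ θ ∧ θ ≤ 1 ∧ (∀ y, 0 ≤ y → y ≤ 1 / 5 → θ * y - 2 * p * y ^ 2 ≤ φ) ∧
      ((1 - p) * Real.exp (-(1 - θ) * Real.log r + φ) + p) * ((1 - p) * r + p) ≤ 1 := by
  rcases le_or_gt r (3 / 4) with h | h
  · refine ⟨1, 1 / 5, by norm_num, le_rfl, fun y _ hy => by nlinarith [sq_nonneg y], ?_⟩
    have he : Real.exp (1 / 5) ≤ 5 / 4 := by
      have h1 : Real.exp (1 / 5) * (1 - 1 / 5) ≤ 1 := by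
        have := Real.add_one_le_exp (-(1 / 5 : ℝ))
        have h2 : Real.exp (1 / 5) * Real.exp (-(1 / 5)) = 1 := by
          rw [← Real.exp_add]; norm_num
        nlinarith [Real.exp_pos (1 / 5 : ℝ)]
      linarith
    have h0 : -(1 - 1) * Real.log r + 1 / 5 = 1 / 5 := by ring
    rw [h0]
    have h1 : (1 - p) * Real.exp (1 / 5) + p ≤ 1 + (1 - p) / 4 := by nlinarith
    have h2 : (1 - p) * r + p ≤ 1 - (1 - p) / 4 := by nlinarith
    have h3 : 0 ≤ (1 - p) * r + p := by nlinarith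
    calc _ ≤ (1 + (1 - p) / 4) * (1 - (1 - p) / 4) := by
          apply mul_le_mul h1 h2 h3; linarith
      _ ≤ 1 := by nlinarith [sq_nonneg (1 - p)]
  · set ε := 1 - r with hε
    have hr : r = 1 - ε := by rw [hε]; ring
    have hε0 : 0 < ε := by linarith
    have hε1 : ε < 1 / 4 := by linarith
    refine ⟨4 * p * ε, 2 * p * ε ^ 2, by positivity, by nlinarith, fun y _ _ => ?_, ?_⟩
    · nlinarith [mul_nonneg hp0.le (sq_nonneg (ε - y))]
    have hlog : Real.log r ≤ -ε := by
      have := Real.log_le_sub_one_of_pos hr0; linarith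
    have h1 : Real.exp (-(1 - 4 * p * ε) * Real.log r + 2 * p * ε ^ 2) ≤
        1 / (r * (1 + 2 * p * ε ^ 2)) := by
      have h2 : -(1 - 4 * p * ε) * Real.log r + 2 * p * ε ^ 2 ≤
          -(Real.log r + 2 * p * ε ^ 2) := by
        have : 4 * p * ε * Real.log r ≤ 4 * p * ε * (-ε) :=
          mul_le_mul_of_nonneg_left hlog (by positivity)
        nlinarith
      calc _ ≤ Real.exp (-(Real.log r + 2 * p * ε ^ 2)) := Real.exp_le_exp.2 h2
        _ = 1 / (r * Real.exp (2 * p * ε ^ 2)) := by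
          rw [Real.exp_neg, Real.exp_add, Real.exp_log hr0, one_div]
        _ ≤ _ := by
          apply one_div_le_one_div_of_le (by positivity)
          apply mul_le_mul_of_nonneg_left _ hr0.le
          linarith [Real.add_one_le_exp (2 * p * ε ^ 2)]
    have hD : 0 < r * (1 + 2 * p * ε ^ 2) := by positivity
    have h3 : 0 ≤ (1 - p) * r + p := by nlinarith
    calc _ ≤ ((1 - p) * (1 / (r * (1 + 2 * p * ε ^ 2))) + p) * ((1 - p) * r + p) := by
          apply mul_le_mul_of_nonneg_right _ h3
          have : 0 ≤ 1 - p := by linarith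
          nlinarith
      _ = (((1 - p) + p * (r * (1 + 2 * p * ε ^ 2))) * ((1 - p) * r + p)) /
            (r * (1 + 2 * p * ε ^ 2)) := by field_simp
      _ ≤ 1 := by
          rw [div_le_one hD]
          have h4 : ((1 - p) + p * r) * ((1 - p) * r + p) = r + p * (1 - p) * ε ^ 2 := by
            rw [hε]; ring
          have h5 : (1 - p) * r + p ≤ 1 := by nlinarith
          have h6 : 2 * p ^ 2 * r * ε ^ 2 * ((1 - p) * r + p) ≤ 2 * p ^ 2 * r * ε ^ 2 :=
            mul_le_of_le_one_right (by positivity) h5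
          have h7 : 0 ≤ p * ε ^ 2 * ((1 - p) * (2 * r - 1)) := by
            have : 0 ≤ 1 - p := by linarith
            have : 0 ≤ 2 * r - 1 := by linarith
            positivity
          nlinarith

/-- A concentration inequality of Talagrand–Maurey type for biased product measures on the cube:
an infimum-convolution inequality, with the transport cost expressed in dual form. -/
lemma exists_infConvolution {p : ℝ} (hp0 : 0 < p) (hp : p ≤ 1 / 2) (U : Finset α) :
    ∀ f : Finset α → ℝ, ∃ q : Finset α → ℝ,
      bernoulliExp p U (fun S => Real.exp (q S)) * bernoulliExp p U (fun S => Real.exp (-f S)) ≤ 1 ∧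
      ∀ S ⊆ U, ∀ y : α → ℝ, (∀ s, 0 ≤ y s ∧ y s ≤ 1 / 5) → ∀ a : ℝ,
        (∀ S' ⊆ U, a ≤ f S' + ∑ s ∈ S' \ S, y s) → a - 2 * p * ∑ s ∈ U, y s ^ 2 ≤ q S := by
  have hp1 : p ≤ 1 := by linarith
  have hp1' : 0 ≤ 1 - p := by linarith
  induction U using Finset.induction_on with
  | empty =>
    refine fun f => ⟨f, ?_, ?_⟩
    · rw [bernoulliExp_empty, bernoulliExp_empty, ← Real.exp_add]; simp
    · intro S hS y _ a ha
      have := ha ∅ (by simp)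
      rw [Finset.subset_empty.1 hS]
      simpa using this
  | insert x U hx ih =>
    intro f
    obtain ⟨q₀, hq₀, hq₀'⟩ := ih f
    obtain ⟨q₁, hq₁, hq₁'⟩ := ih (fun S => f (insert x S))
    set a₀ := bernoulliExp p U (fun S => Real.exp (-f S)) with ha₀
    set a₁ := bernoulliExp p U (fun S => Real.exp (-f (insert x S))) with ha₁
    have ha₀pos : 0 < a₀ := bernoulliExp_pos hp0.le hp1 U fun S => Real.exp_pos _
    have ha₁pos : 0 < a₁ := bernoulliExp_pos hp0.le hp1 U fun S => Real.exp_pos _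
    have hpos₀ : 0 < bernoulliExp p U (fun S => Real.exp (q₀ S)) :=
      bernoulliExp_pos hp0.le hp1 U fun S => Real.exp_pos _
    have hpos₁ : 0 < bernoulliExp p U (fun S => Real.exp (q₁ S)) :=
      bernoulliExp_pos hp0.le hp1 U fun S => Real.exp_pos _
    have hsum : ∀ y : α → ℝ, ∑ s ∈ insert x U, y s ^ 2 = y x ^ 2 + ∑ s ∈ U, y s ^ 2 :=
      fun y => Finset.sum_insert hx
    have hnot : ∀ {S : Finset α}, S ⊆ U → x ∉ S := fun h h' => hx (h h')
    have herase : ∀ {S : Finset α}, S ⊆ insert x U → S.erase x ⊆ U := fun h =>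
      (Finset.erase_subset_erase x h).trans (by rw [Finset.erase_insert hx])
    have hF : bernoulliExp p (insert x U) (fun S => Real.exp (-f S)) = (1 - p) * a₀ + p * a₁ :=
      bernoulliExp_insert p hx _
    rcases le_or_gt a₁ a₀ with hle | hlt
    · refine ⟨fun S => q₀ (S.erase x), ?_, ?_⟩
      · have hQ : bernoulliExp p (insert x U) (fun S => Real.exp (q₀ (S.erase x))) =
            bernoulliExp p U (fun S => Real.exp (q₀ S)) := by
          rw [bernoulliExp_insert p hx,
            bernoulliExp_congr (g := fun S => Real.exp (q₀ S)) fun S hS => by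
              rw [Finset.erase_eq_of_notMem (hnot hS)],
            bernoulliExp_congr (f := fun S => Real.exp (q₀ ((insert x S).erase x)))
              (g := fun S => Real.exp (q₀ S)) fun S hS => by
              rw [Finset.erase_insert (hnot hS)]]
          ring
        rw [hQ, hF]
        calc _ ≤ bernoulliExp p U (fun S => Real.exp (q₀ S)) * a₀ := by
              apply mul_le_mul_of_nonneg_left _ hpos₀.le
              nlinarith
          _ ≤ 1 := hq₀
      · intro S hS y hy a ha
        have := hq₀' (S.erase x) (herase hS) y hy a fun S' hS' => by
          have h1 := ha S' (hS'.trans (Finset.subset_insert _ _))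
          have h2 : S' \ S.erase x = S' \ S := by
            ext s
            have : s ∈ S' → s ≠ x := fun h h' => hnot hS' (h' ▸ h)
            simp only [Finset.mem_sdiff, Finset.mem_erase]
            tauto
          rwa [h2]
        rw [hsum]
        have : 0 ≤ p * y x ^ 2 := by positivity
        dsimp only
        linarith
    · obtain ⟨θ, φ, hθ0, hθ1, hφ, hmain⟩ := exists_interpolation (r := a₀ / a₁) hp0 hp
        (by positivity) ((div_lt_one ha₁pos).2 hlt)
      refine ⟨fun S => if x ∈ S then q₁ (S.erase x) else (1 - θ) * q₀ S + θ * q₁ S + φ, ?_, ?_⟩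
      · rw [hF, bernoulliExp_insert p hx,
          bernoulliExp_congr (g := fun S => Real.exp ((1 - θ) * q₀ S + θ * q₁ S + φ))
            fun S hS => by dsimp only; rw [if_neg (hnot hS)],
          bernoulliExp_congr (f := fun S => Real.exp (if x ∈ insert x S then _ else _))
            (g := fun S => Real.exp (q₁ S)) fun S hS => by
            rw [if_pos (Finset.mem_insert_self _ _), Finset.erase_insert (hnot hS)]]
        set C := Real.exp (-(1 - θ) * Real.log a₀ - θ * Real.log a₁ + φ) with hC
        have hE0 : bernoulliExp p U (fun S => Real.exp ((1 - θ) * q₀ S + θ * q₁ S + φ)) ≤ C := by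
          calc _ ≤ bernoulliExp p U (fun S => C * ((1 - θ) * a₀ * Real.exp (q₀ S) +
                  θ * a₁ * Real.exp (q₁ S))) := by
                refine bernoulliExp_mono hp0.le hp1 fun S _ => ?_
                have h1 := convexOn_exp.2 (Set.mem_univ (q₀ S + Real.log a₀))
                  (Set.mem_univ (q₁ S + Real.log a₁)) (sub_nonneg.2 hθ1) hθ0 (by ring)
                simp only [smul_eq_mul, Real.exp_add, Real.exp_log ha₀pos,
                  Real.exp_log ha₁pos] at h1
                have h2 : Real.exp ((1 - θ) * q₀ S + θ * q₁ S + φ) =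
                    C * (Real.exp ((1 - θ) * (q₀ S + Real.log a₀)) *
                      Real.exp (θ * (q₁ S + Real.log a₁))) := by
                  rw [hC, ← Real.exp_add, ← Real.exp_add]; congr 1; ring
                rw [h2]
                exact mul_le_mul_of_nonneg_left (by linarith) (Real.exp_pos _).le
            _ = C * ((1 - θ) * (bernoulliExp p U (fun S => Real.exp (q₀ S)) * a₀) +
                  θ * (bernoulliExp p U (fun S => Real.exp (q₁ S)) * a₁)) := by
                rw [bernoulliExp_mul_left, bernoulliExp_add, bernoulliExp_mul_left,
                  bernoulliExp_mul_left]
                ring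
            _ ≤ C * 1 := by
                apply mul_le_mul_of_nonneg_left _ (Real.exp_pos _).le
                nlinarith
            _ = C := mul_one C
        have hE1 : bernoulliExp p U (fun S => Real.exp (q₁ S)) ≤ 1 / a₁ := by
          rw [le_div_iff₀ ha₁pos]; exact hq₁
        have hC' : C = Real.exp (-(1 - θ) * Real.log (a₀ / a₁) + φ) / a₁ := by
          rw [eq_div_iff ha₁pos.ne', hC, Real.log_div ha₀pos.ne' ha₁pos.ne']
          nth_rewrite 2 [← Real.exp_log ha₁pos]
          rw [← Real.exp_add]
          congr 1; ring
        calc _ ≤ ((1 - p) * C + p * (1 / a₁)) * ((1 - p) * a₀ + p * a₁) := by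
              apply mul_le_mul_of_nonneg_right _ (by positivity)
              exact add_le_add (mul_le_mul_of_nonneg_left hE0 hp1')
                (mul_le_mul_of_nonneg_left hE1 hp0.le)
          _ = ((1 - p) * Real.exp (-(1 - θ) * Real.log (a₀ / a₁) + φ) + p) *
                ((1 - p) * (a₀ / a₁) + p) := by
              rw [hC']; field_simp
          _ ≤ 1 := hmain
      · intro S hS y hy a ha
        have hS0 : S.erase x ⊆ U := herase hS
        by_cases hxS : x ∈ S
        · have := hq₁' (S.erase x) hS0 y hy a fun S' hS' => by
            have h1 := ha (insert x S') (Finset.insert_subset_insert _ hS')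
            have h2 : insert x S' \ S = S' \ S.erase x := by
              ext s
              have : s ∈ S' → s ≠ x := fun h h' => hnot hS' (h' ▸ h)
              simp only [Finset.mem_sdiff, Finset.mem_erase, Finset.mem_insert]
              by_cases hs : s = x
              · subst hs; tauto
              · tauto
            rwa [h2] at h1
          rw [hsum]
          have : 0 ≤ p * y x ^ 2 := by positivity
          simp only [if_pos hxS]
          linarith
        · have hSU : S ⊆ U := by rwa [Finset.erase_eq_of_notMem hxS] at hS0
          have h0 := hq₀' S hSU y hy a fun S' hS' => ha S' (hS'.trans (Finset.subset_insert _ _))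
          have h1 := hq₁' S hSU y hy (a - y x) fun S' hS' => by
            have h1 := ha (insert x S') (Finset.insert_subset_insert _ hS')
            rw [Finset.insert_sdiff_of_notMem _ hxS, Finset.sum_insert
              (fun h => hnot hS' (Finset.mem_sdiff.1 h).1)] at h1
            linarith
          have h2 := hφ (y x) (hy x).1 (hy x).2
          rw [hsum]
          simp only [if_neg hxS]
          have h3 := mul_le_mul_of_nonneg_left h0 (sub_nonneg.2 hθ1)
          have h4 := mul_le_mul_of_nonneg_left h1 hθ0
          nlinarith

end Bernoulli

section BernoulliProb

variable {α : Type*}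

/-- Probability of the event `E` for a random subset of `U` including each element independently
with probability `p`. -/
noncomputable def bernoulliProb (p : ℝ) (U : Finset α) (E : Finset α → Prop) : ℝ :=
  bernoulliExp p U (Set.indicator {S | E S} fun _ => 1)

lemma bernoulliProb_mono {p : ℝ} (hp0 : 0 ≤ p) (hp1 : p ≤ 1) {U : Finset α}
    {E F : Finset α → Prop} (h : ∀ S ⊆ U, E S → F S) :
    bernoulliProb p U E ≤ bernoulliProb p U F := by
  refine bernoulliExp_mono hp0 hp1 fun S hS => ?_
  by_cases hE : E S
  · simp [Set.indicator, hE, h S hS hE]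
  · simp only [Set.indicator, Set.mem_ofPred_eq, if_neg hE]
    split_ifs <;> norm_num

lemma bernoulliProb_le_exp {p : ℝ} (hp0 : 0 ≤ p) (hp1 : p ≤ 1) {U : Finset α}
    {E : Finset α → Prop} {f : Finset α → ℝ} (hf : ∀ S, 0 ≤ f S)
    (h : ∀ S ⊆ U, E S → 1 ≤ f S) : bernoulliProb p U E ≤ bernoulliExp p U f := by
  refine bernoulliExp_mono hp0 hp1 fun S hS => ?_
  by_cases hE : E S
  · simpa [Set.indicator, hE] using h S hS hE
  · simpa [Set.indicator, hE] using hf S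

lemma bernoulliProb_exists_le {ι : Type*} {p : ℝ} (hp0 : 0 ≤ p) (hp1 : p ≤ 1) (U : Finset α)
    (I : Finset ι) (E : ι → Finset α → Prop) :
    bernoulliProb p U (fun S => ∃ i ∈ I, E i S) ≤ ∑ i ∈ I, bernoulliProb p U (E i) := by
  unfold bernoulliProb
  rw [← bernoulliExp_sum]
  refine bernoulliProb_le_exp hp0 hp1 (fun S => Finset.sum_nonneg fun i _ => ?_)
    fun S _ ⟨i, hi, hE⟩ => ?_
  · exact Set.indicator_nonneg (fun _ _ => zero_le_one) _
  · have h1 : ({S | E i S} : Set (Finset α)).indicator (fun _ => (1 : ℝ)) S = 1 := by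
      simp [Set.indicator, hE]
    refine h1.symm.trans_le ?_
    exact Finset.single_le_sum
      (f := fun i => ({S | E i S} : Set (Finset α)).indicator (fun _ => (1 : ℝ)) S)
      (fun i _ => Set.indicator_nonneg (fun _ _ => zero_le_one) _) hi

lemma bernoulliProb_or_le {p : ℝ} (hp0 : 0 ≤ p) (hp1 : p ≤ 1) (U : Finset α)
    (E F : Finset α → Prop) :
    bernoulliProb p U (fun S => E S ∨ F S) ≤ bernoulliProb p U E + bernoulliProb p U F := by
  unfold bernoulliProb
  rw [← bernoulliExp_add]
  refine bernoulliExp_mono hp0 hp1 fun S _ => ?_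
  by_cases hE : E S <;> by_cases hF : F S <;> simp [Set.indicator, hE, hF]

variable [DecidableEq α]

lemma bernoulliProb_not (p : ℝ) (U : Finset α) (E : Finset α → Prop) :
    bernoulliProb p U (fun S => ¬ E S) = 1 - bernoulliProb p U E := by
  rw [eq_sub_iff_add_eq]
  unfold bernoulliProb
  rw [← bernoulliExp_add]
  refine (bernoulliExp_congr (g := fun _ => 1) fun S _ => ?_).trans (bernoulliExp_const p U 1)
  by_cases hE : E S <;> simp [Set.indicator, hE]

lemma bernoulliProb_inter_eq_empty_le {p : ℝ} (hp0 : 0 ≤ p) (hp1 : p ≤ 1) {U A : Finset α}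
    (hA : A ⊆ U) : bernoulliProb p U (fun S => A ∩ S = ∅) ≤ Real.exp (-p * A.card) := by
  calc _ ≤ bernoulliExp p U (fun S => ∏ s ∈ U, if s ∈ S then (if s ∈ A then 0 else 1) else 1) := by
        refine bernoulliProb_le_exp hp0 hp1 (fun S => Finset.prod_nonneg fun s _ => ?_)
          fun S _ hE => ?_
        · split_ifs <;> norm_num
        · rw [Finset.prod_eq_one]
          intro s _
          split_ifs with h1 h2
          · exact absurd (Finset.mem_inter.2 ⟨h2, h1⟩) (by simp [hE])
          · rfl
          · rfl
    _ = ∏ s ∈ U, if s ∈ A then 1 - p else 1 := by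
        rw [bernoulliExp_prod]
        refine Finset.prod_congr rfl fun s _ => ?_
        split_ifs <;> ring
    _ = (1 - p) ^ A.card := by
        rw [Finset.prod_ite_mem, Finset.inter_eq_right.2 hA, Finset.prod_const]
    _ ≤ Real.exp (-p) ^ A.card := by
        have := Real.one_sub_le_exp_neg p
        exact pow_le_pow_left₀ (by linarith) this _
    _ = _ := by rw [← Real.exp_nat_mul]; ring_nf

lemma bernoulliProb_le_sum_le {p : ℝ} (hp0 : 0 ≤ p) (hp1 : p ≤ 1) {U Q : Finset α}
    (hQ : Q ⊆ U) (d : α → ℝ) (hd : ∀ s ∈ Q, |d s| ≤ 1) {l t : ℝ} (hl0 : 0 ≤ l) (hl1 : l ≤ 1) :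
    bernoulliProb p U (fun S => t ≤ ∑ s ∈ Q, (p - if s ∈ S then 1 else 0) * d s) ≤
      Real.exp (p * l ^ 2 * Q.card - l * t) := by
  have key : ∀ S : Finset α, Real.exp (l * ∑ s ∈ Q, (p - if s ∈ S then 1 else 0) * d s) =
      ∏ s ∈ Q, if s ∈ S then Real.exp (l * ((p - 1) * d s)) else Real.exp (l * (p * d s)) := by
    intro S
    rw [Finset.mul_sum, Real.exp_sum]
    refine Finset.prod_congr rfl fun s _ => ?_
    split_ifs <;> simp
  calc _ ≤ bernoulliExp p U (fun S => Real.exp (-(l * t)) *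
            ∏ s ∈ U, if s ∈ S then (if s ∈ Q then Real.exp (l * ((p - 1) * d s)) else 1)
              else (if s ∈ Q then Real.exp (l * (p * d s)) else 1)) := by
        have h : ∀ S : Finset α, Real.exp (-(l * t)) *
            (∏ s ∈ U, if s ∈ S then (if s ∈ Q then Real.exp (l * ((p - 1) * d s)) else 1)
              else (if s ∈ Q then Real.exp (l * (p * d s)) else 1)) =
            Real.exp (l * (∑ s ∈ Q, (p - if s ∈ S then 1 else 0) * d s - t)) := by
          intro S
          have h1 : (∏ s ∈ U, if s ∈ S then (if s ∈ Q then Real.exp (l * ((p - 1) * d s)) else 1)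
              else (if s ∈ Q then Real.exp (l * (p * d s)) else 1)) =
              ∏ s ∈ U, if s ∈ Q then (if s ∈ S then Real.exp (l * ((p - 1) * d s))
                else Real.exp (l * (p * d s))) else 1 := by
            refine Finset.prod_congr rfl fun s _ => ?_
            split_ifs <;> rfl
          rw [h1, Finset.prod_ite_mem, Finset.inter_eq_right.2 hQ, ← key, ← Real.exp_add]
          congr 1; ring
        refine bernoulliProb_le_exp hp0 hp1 (fun S => ?_) fun S _ hE => ?_
        · rw [h]; exact (Real.exp_pos _).le
        · rw [h]
          refine Real.one_le_exp (mul_nonneg hl0 (by linarith))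
    _ = Real.exp (-(l * t)) * ∏ s ∈ Q,
          (p * Real.exp (l * ((p - 1) * d s)) + (1 - p) * Real.exp (l * (p * d s))) := by
        rw [bernoulliExp_mul_left, bernoulliExp_prod]
        congr 1
        rw [← Finset.inter_eq_right.2 hQ, ← Finset.prod_ite_mem, Finset.inter_eq_right.2 hQ]
        refine Finset.prod_congr rfl fun s _ => ?_
        split_ifs <;> ring
    _ ≤ Real.exp (-(l * t)) * ∏ s ∈ Q, Real.exp (p * l ^ 2) := by
        refine mul_le_mul_of_nonneg_left (Finset.prod_le_prod (fun s _ => ?_) fun s hs => ?_)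
          (Real.exp_pos _).le
        · have : 0 ≤ 1 - p := by linarith
          positivity
        · have hx : |-(l * d s)| ≤ 1 := by
            rw [abs_neg, abs_mul, abs_of_nonneg hl0]
            exact mul_le_one₀ hl1 (abs_nonneg _) (hd s hs)
          have h1 := (abs_le.1 (Real.abs_exp_sub_one_sub_id_le hx)).2
          have h2 : d s ^ 2 ≤ 1 := by
            rw [← sq_abs]; exact pow_le_one₀ (abs_nonneg _) (hd s hs)
          have h3 : Real.exp (-(l * d s)) - 1 ≤ -(l * d s) + l ^ 2 := by
            have : (-(l * d s)) ^ 2 ≤ l ^ 2 := by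
              rw [neg_sq, mul_pow]; exact mul_le_of_le_one_right (sq_nonneg _) h2
            linarith
          have h4 := Real.add_one_le_exp (p * (Real.exp (-(l * d s)) - 1))
          calc _ = Real.exp (l * (p * d s)) *
                (p * (Real.exp (-(l * d s)) - 1) + 1) := by
                have : Real.exp (l * ((p - 1) * d s)) =
                    Real.exp (l * (p * d s)) * Real.exp (-(l * d s)) := by
                  rw [← Real.exp_add]; congr 1; ring
                rw [this]; ring
            _ ≤ Real.exp (l * (p * d s)) * Real.exp (p * (-(l * d s) + l ^ 2)) := by
                refine mul_le_mul_of_nonneg_left (h4.trans (Real.exp_le_exp.2 ?_))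
                  (Real.exp_pos _).le
                exact mul_le_mul_of_nonneg_left h3 hp0
            _ = Real.exp (p * l ^ 2) := by rw [← Real.exp_add]; congr 1; ring
    _ = _ := by
        rw [Finset.prod_const, ← Real.exp_nat_mul, ← Real.exp_add]; congr 1; ring

end BernoulliProb

section Sampling

open scoped BigOperators

variable {Ω : Type*} [Fintype Ω]

lemma expect_fin_succ {k : ℕ} (f : (Fin (k + 1) → Ω) → ℝ) :
    𝔼 a, f a = 𝔼 x, 𝔼 a : Fin k → Ω, f (Fin.cons x a) := by
  rw [← Fintype.expect_equiv (Fin.consEquiv fun _ : Fin (k + 1) => Ω)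
    (fun z => f (Fin.cons z.1 z.2)) f fun _ => rfl, ← Finset.univ_product_univ,
    Finset.expect_product]

lemma expect_prod_apply (k : ℕ) (f : Ω → ℝ) :
    𝔼 a : Fin k → Ω, ∏ i, f (a i) = (𝔼 x, f x) ^ k := by
  induction k with
  | zero => simp [Finset.expect_univ]
  | succ k ih =>
    rw [expect_fin_succ, pow_succ', Finset.expect_mul]
    refine Finset.expect_congr rfl fun x _ => ?_
    simp only [Fin.prod_univ_succ, Fin.cons_zero, Fin.cons_succ]
    rw [← Finset.mul_expect, ih]

variable [Nonempty Ω]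

lemma expect_sum_apply (k : ℕ) (u : Ω → ℝ) :
    𝔼 a : Fin k → Ω, ∑ i, u (a i) = k * 𝔼 x, u x := by
  induction k with
  | zero => simp
  | succ k ih =>
    rw [expect_fin_succ]
    simp only [Fin.sum_univ_succ, Fin.cons_zero, Fin.cons_succ, Finset.expect_add_distrib, ih,
      Fintype.expect_const]
    push_cast; ring

lemma expect_sum_apply_sq_le (k : ℕ) (u : Ω → ℝ) :
    𝔼 a : Fin k → Ω, (∑ i, u (a i)) ^ 2 ≤ k ^ 2 * (𝔼 x, u x) ^ 2 + k * 𝔼 x, u x ^ 2 := by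
  induction k with
  | zero => simp
  | succ k ih =>
    rw [expect_fin_succ]
    simp only [Fin.sum_univ_succ, Fin.cons_zero, Fin.cons_succ, add_sq, Finset.expect_add_distrib,
      Fintype.expect_const, ← Finset.mul_expect, expect_sum_apply, ← Finset.expect_mul]
    push_cast
    nlinarith [sq_nonneg (𝔼 x, u x)]

/-- Simultaneous one-sided sampling: if `k` is large in terms of the number of bounded test
functions, some `k`-sample has all empirical means close to the true means. -/
lemma exists_sample {J : Type*} [Fintype J] {k : ℕ} (u : J → Ω → ℝ) (hu : ∀ j x, |u j x| ≤ 1)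
    {η : ℝ} (hη0 : 0 < η) (hη1 : η ≤ 1)
    (hk : Fintype.card J * Real.exp (-(η ^ 2 * k / 16)) < 1) :
    ∃ a : Fin k → Ω, ∀ j, ∑ i, u j (a i) - k * 𝔼 x, u j x ≤ η * k := by
  set μ : J → ℝ := fun j => 𝔼 x, u j x with hμ
  have hμ1 : ∀ j, |μ j| ≤ 1 := fun j =>
    (Finset.abs_expect_le _ _).trans (Finset.expect_le Finset.univ_nonempty fun x _ => hu j x)
  have hmom : ∀ j, 𝔼 x, Real.exp (η / 8 * (u j x - μ j)) ≤ Real.exp (η ^ 2 / 16) := by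
    intro j
    calc _ ≤ 𝔼 x, (1 + η / 8 * (u j x - μ j) + η ^ 2 / 16) := by
          refine Finset.expect_le_expect fun x _ => ?_
          have h2 : |u j x - μ j| ≤ 2 := by
            have := abs_sub (u j x) (μ j)
            linarith [hu j x, hμ1 j]
          have h1 : |η / 8 * (u j x - μ j)| ≤ 1 := by
            rw [abs_mul, abs_of_pos (by positivity)]
            nlinarith [abs_nonneg (u j x - μ j)]
          have h3 := (abs_le.1 (Real.abs_exp_sub_one_sub_id_le h1)).2
          have h4 : (u j x - μ j) ^ 2 ≤ 4 := by
            rw [← sq_abs]; nlinarith [abs_nonneg (u j x - μ j)]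
          have h5 : (η / 8 * (u j x - μ j)) ^ 2 ≤ η ^ 2 / 16 := by
            rw [mul_pow]; nlinarith [sq_nonneg η]
          linarith
      _ = 1 + η ^ 2 / 16 := by
          rw [Finset.expect_add_distrib, Finset.expect_add_distrib, Fintype.expect_const,
            Fintype.expect_const, ← Finset.mul_expect, Finset.expect_sub_distrib,
            Fintype.expect_const]
          simp [hμ]
      _ ≤ _ := by linarith [Real.add_one_le_exp (η ^ 2 / 16)]
  have hE : 𝔼 a : Fin k → Ω, ∑ j, Real.exp (η / 8 * (∑ i, u j (a i) - k * μ j - η * k)) < 1 := by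
    rw [Finset.expect_sum_comm]
    calc _ ≤ ∑ j : J, Real.exp (-(η ^ 2 * k / 16)) := by
          refine Finset.sum_le_sum fun j _ => ?_
          have h1 : ∀ a : Fin k → Ω, Real.exp (η / 8 * (∑ i, u j (a i) - k * μ j - η * k)) =
              Real.exp (-(η ^ 2 * k / 8)) * ∏ i, Real.exp (η / 8 * (u j (a i) - μ j)) := by
            intro a
            rw [← Real.exp_sum, ← Finset.mul_sum, Finset.sum_sub_distrib, ← Real.exp_add]
            simp only [Finset.sum_const, Finset.card_univ, Fintype.card_fin, nsmul_eq_mul]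
            congr 1; ring
          simp only [h1]
          rw [← Finset.mul_expect, expect_prod_apply k fun x => Real.exp (η / 8 * (u j x - μ j))]
          calc _ ≤ Real.exp (-(η ^ 2 * k / 8)) * Real.exp (η ^ 2 / 16) ^ k := by
                refine mul_le_mul_of_nonneg_left (pow_le_pow_left₀ ?_ (hmom j) k)
                  (Real.exp_pos _).le
                exact Finset.expect_nonneg fun x _ => (Real.exp_pos _).le
            _ = _ := by
                rw [← Real.exp_nat_mul, ← Real.exp_add]; congr 1; ring
      _ < 1 := by simpa using hk
  obtain ⟨a, -, ha⟩ := Finset.exists_lt_of_expect_lt Finset.univ_nonempty hE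
  refine ⟨a, fun j => ?_⟩
  have h1 := (Finset.single_le_sum
    (f := fun j => Real.exp (η / 8 * (∑ i, u j (a i) - k * μ j - η * k)))
    (fun j _ => (Real.exp_pos _).le) (Finset.mem_univ j)).trans_lt ha
  have h2 := Real.exp_lt_one_iff.1 h1
  by_contra! h3
  have : 0 < η / 8 * (∑ i, u j (a i) - k * μ j - η * k) := by
    apply mul_pos (by positivity); linarith
  linarith

end Sampling

section SumRep

open scoped BigOperators

variable {G : Type*} [AddCommGroup G] [DecidableEq G]

/-- The number of representations of `s` as a sum of two elements of `B`. -/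
def sumRep (B : Finset G) (s : G) : ℝ := ∑ x ∈ B, ∑ y ∈ B, if x + y = s then 1 else 0

lemma sumRep_nonneg (B : Finset G) (s : G) : 0 ≤ sumRep B s :=
  Finset.sum_nonneg fun _ _ => Finset.sum_nonneg fun _ _ => by split_ifs <;> norm_num

lemma sum_ite_add_le_one (B : Finset G) (x s : G) :
    ∑ y ∈ B, (if x + y = s then (1 : ℝ) else 0) ≤ 1 := by
  have : ∀ y, (x + y = s) = (y = s - x) := fun y => by
    rw [eq_sub_iff_add_eq', add_comm x]
  simp only [this, Finset.sum_ite_eq']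
  split_ifs <;> norm_num

lemma sumRep_le (B : Finset G) (s : G) : sumRep B s ≤ B.card := by
  calc _ ≤ ∑ x ∈ B, (1 : ℝ) := Finset.sum_le_sum fun x _ => sum_ite_add_le_one B x s
    _ = _ := by simp

lemma sum_sumRep [Fintype G] (B : Finset G) : ∑ s, sumRep B s = (B.card : ℝ) ^ 2 := by
  unfold sumRep
  rw [Finset.sum_comm]
  simp_rw [Finset.sum_comm (s := (Finset.univ : Finset G)), Finset.sum_ite_eq]
  simp [sq]

lemma sumRep_eq_zero_of_notMem {B : Finset G} {s : G} (hs : s ∉ B + B) : sumRep B s = 0 := by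
  refine Finset.sum_eq_zero fun x hx => Finset.sum_eq_zero fun y hy => if_neg ?_
  rintro rfl
  exact hs (Finset.add_mem_add hx hy)

/-- If most of the mass of `sumRep B` sits on elements with few representations, then two random
`k`-element samples from `B` have a sumset of size of order `k ^ 2`. -/
lemma exists_large_sumset {B T : Finset G} {k : ℕ} (hk : 0 < k) (hkB : 4 * k ≤ B.card)
    (hT : ∀ s ∈ T, 2 * (k : ℝ) ^ 2 * sumRep B s ≤ (B.card : ℝ) ^ 2)
    (hsum : (B.card : ℝ) ^ 2 / 2 ≤ ∑ s ∈ T, sumRep B s) :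
    ∃ a a' : Fin k → G, (∀ i, a i ∈ B) ∧ (∀ i, a' i ∈ B) ∧
      (k : ℝ) ^ 2 / 4 ≤ ((Finset.univ.image a + Finset.univ.image a').card : ℝ) := by
  set m : ℝ := (B.card : ℝ) with hm
  have hBne : B.Nonempty := Finset.card_pos.1 (by omega)
  have : Nonempty B := hBne.to_subtype
  have hm0 : 0 < m := by rw [hm]; exact_mod_cast Finset.card_pos.2 hBne
  have hk0 : (0 : ℝ) < k := by exact_mod_cast hk
  have hkm : 4 * (k : ℝ) ≤ m := by rw [hm]; exact_mod_cast hkB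
  have hexp : ∀ f : G → ℝ, 𝔼 x : B, f x = (∑ x ∈ B, f x) / m := fun f => by
    rw [Fintype.expect_eq_sum_div_card, Finset.sum_coe_sort B f, Fintype.card_coe]
  set w : G → G → ℝ := fun s x => (∑ y ∈ B, if x + y = s then 1 else 0) / m with hw
  have hw0 : ∀ s x, 0 ≤ w s x := fun s x =>
    div_nonneg (Finset.sum_nonneg fun _ _ => by split_ifs <;> norm_num) hm0.le
  have hw1 : ∀ s x, w s x ≤ 1 / m := fun s x =>
    div_le_div_of_nonneg_right (sum_ite_add_le_one B x s) hm0.le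
  have hEw : ∀ s, 𝔼 x : B, w s x = sumRep B s / m ^ 2 := fun s => by
    rw [hexp (w s), hw]
    simp only [← Finset.sum_div]
    rw [div_div, sq]; rfl
  have hEw2 : ∀ s, 𝔼 x : B, w s x ^ 2 ≤ sumRep B s / m ^ 2 / m := fun s => by
    rw [← hEw, Finset.expect_div]
    refine Finset.expect_le_expect fun x _ => ?_
    rw [sq, div_eq_mul_one_div (w s x)]
    exact mul_le_mul_of_nonneg_left (hw1 s x) (hw0 s x)
  have hEx : ∀ s y, 𝔼 x : B, (if (x : G) + y = s then (1 : ℝ) else 0) = w s y := fun s y => by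
    rw [hexp fun x => if x + y = s then (1 : ℝ) else 0]
    simp only [hw, add_comm y]
  have hEy : ∀ s x, 𝔼 y : B, (if x + (y : G) = s then (1 : ℝ) else 0) = w s x := fun s x =>
    hexp fun y => if x + y = s then (1 : ℝ) else 0
  set c : G → (Fin k → B) → (Fin k → B) → ℝ := fun s a a' =>
    ∑ i, ∑ j, if (a i : G) + a' j = s then 1 else 0 with hc
  have hEc : ∀ s, 𝔼 a', 𝔼 a, c s a a' = k ^ 2 * (sumRep B s / m ^ 2) := fun s => by
    have h1 : ∀ a', 𝔼 a, c s a a' = k * ∑ j, w s (a' j) := fun a' => by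
      rw [hc]
      rw [expect_sum_apply k fun x : B => ∑ j, if (x : G) + a' j = s then (1 : ℝ) else 0,
        Finset.expect_sum_comm]
      simp only [hEx]
    simp only [h1]
    rw [← Finset.mul_expect, expect_sum_apply k fun x : B => w s x, hEw]
    ring
  have hEc2 : ∀ s, 𝔼 a', 𝔼 a, c s a a' ^ 2 ≤
      k ^ 4 * (sumRep B s / m ^ 2) ^ 2 + 2 * k ^ 3 * (sumRep B s / m ^ 2 / m) +
        k ^ 2 * (sumRep B s / m ^ 2) := fun s => by
    have h1 : ∀ a', 𝔼 a, c s a a' ^ 2 ≤ k ^ 2 * (∑ j, w s (a' j)) ^ 2 +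
        k * 𝔼 x : B, (∑ j, if (x : G) + a' j = s then (1 : ℝ) else 0) ^ 2 := fun a' => by
      refine (expect_sum_apply_sq_le k
        fun x : B => ∑ j, if (x : G) + a' j = s then (1 : ℝ) else 0).trans_eq ?_
      rw [Finset.expect_sum_comm]
      simp only [hEx]
    have h2 : 𝔼 a' : Fin k → B, (∑ j, w s (a' j)) ^ 2 ≤
        k ^ 2 * (sumRep B s / m ^ 2) ^ 2 + k * (sumRep B s / m ^ 2 / m) := by
      refine (expect_sum_apply_sq_le k fun x : B => w s x).trans ?_
      rw [hEw]
      gcongr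
      exact hEw2 s
    have h3 : 𝔼 a' : Fin k → B, 𝔼 x : B,
        (∑ j, if (x : G) + a' j = s then (1 : ℝ) else 0) ^ 2 ≤
        k ^ 2 * (sumRep B s / m ^ 2 / m) + k * (sumRep B s / m ^ 2) := by
      rw [Finset.expect_comm]
      calc _ ≤ 𝔼 x : B, ((k : ℝ) ^ 2 * w s x ^ 2 + k * w s x) := by
            refine Finset.expect_le_expect fun x _ => ?_
            refine (expect_sum_apply_sq_le k
              fun y : B => if (x : G) + y = s then (1 : ℝ) else 0).trans_eq ?_
            simp only [ite_pow, one_pow, ne_eq, OfNat.ofNat_ne_zero, not_false_eq_true, zero_pow,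
              hEy]
        _ ≤ _ := by
            rw [Finset.expect_add_distrib, ← Finset.mul_expect, ← Finset.mul_expect, hEw]
            gcongr
            exact hEw2 s
    calc _ ≤ 𝔼 a' : Fin k → B, ((k : ℝ) ^ 2 * (∑ j, w s (a' j)) ^ 2 +
        k * 𝔼 x : B, (∑ j, if (x : G) + a' j = s then (1 : ℝ) else 0) ^ 2) :=
          Finset.expect_le_expect fun a' _ => h1 a'
      _ ≤ k ^ 2 * (k ^ 2 * (sumRep B s / m ^ 2) ^ 2 + k * (sumRep B s / m ^ 2 / m)) +
          k * (k ^ 2 * (sumRep B s / m ^ 2 / m) + k * (sumRep B s / m ^ 2)) := by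
          rw [Finset.expect_add_distrib, ← Finset.mul_expect, ← Finset.mul_expect]
          gcongr
      _ = _ := by ring
  have hmain : (k : ℝ) ^ 2 / 4 ≤
      𝔼 z : (Fin k → B) × (Fin k → B), ∑ s ∈ T, (3 * c s z.2 z.1 - c s z.2 z.1 ^ 2) / 2 := by
    rw [Finset.expect_sum_comm]
    calc (k : ℝ) ^ 2 / 4 = k ^ 2 / (2 * m ^ 2) * (m ^ 2 / 2) := by field_simp; norm_num
      _ ≤ k ^ 2 / (2 * m ^ 2) * ∑ s ∈ T, sumRep B s := by gcongr
      _ ≤ _ := by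
        rw [Finset.mul_sum]
        refine Finset.sum_le_sum fun s hs => ?_
        rw [← Finset.expect_div, Finset.expect_sub_distrib, ← Finset.mul_expect,
          ← Finset.univ_product_univ, Finset.expect_product, Finset.expect_product]
        dsimp only
        rw [hEc]
        have h1 := hEc2 s
        set ρ := sumRep B s / m ^ 2 with hρ
        have hρ0 : 0 ≤ ρ := div_nonneg (sumRep_nonneg B s) (sq_nonneg m)
        have h2 : 2 * (k : ℝ) ^ 2 * ρ ≤ 1 := by
          rw [hρ, ← mul_div_assoc, div_le_one (by positivity)]
          exact hT s hs
        have h3 : 4 * (k ^ 3 * (ρ / m)) ≤ k ^ 2 * ρ := by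
          rw [← mul_div_assoc, ← mul_div_assoc, div_le_iff₀ hm0]
          have := mul_le_mul_of_nonneg_left hkm (by positivity : 0 ≤ (k : ℝ) ^ 2 * ρ)
          linarith
        have h4 : 2 * (k ^ 4 * ρ ^ 2) ≤ (k : ℝ) ^ 2 * ρ := by
          have := mul_le_mul_of_nonneg_left h2 (by positivity : 0 ≤ (k : ℝ) ^ 2 * ρ)
          linarith
        have h5 : (k : ℝ) ^ 2 / (2 * m ^ 2) * sumRep B s = k ^ 2 * ρ / 2 := by
          rw [hρ]; field_simp
        rw [h5]
        linarith
  obtain ⟨⟨a', a⟩, -, ha⟩ := Finset.exists_le_of_le_expect Finset.univ_nonempty hmain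
  refine ⟨fun i => a i, fun i => a' i, fun i => (a i).2, fun i => (a' i).2, ha.trans ?_⟩
  calc _ ≤ ∑ s ∈ T, if s ∈ (Finset.univ.image fun i => (a i : G)) +
        (Finset.univ.image fun i => (a' i : G)) then (1 : ℝ) else 0 := by
        refine Finset.sum_le_sum fun s _ => ?_
        split_ifs with h
        · obtain ⟨N, hN⟩ : ∃ N : ℕ, c s a a' = N :=
            ⟨∑ i, ∑ j, if (a i : G) + a' j = s then 1 else 0, by push_cast; rfl⟩
          dsimp only
          rw [hN]
          rcases Nat.lt_or_ge N 2 with h1 | h1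
          · interval_cases N <;> norm_num
          · have : (2 : ℝ) ≤ N := by exact_mod_cast h1
            nlinarith
        · have : c s a a' = 0 := by
            refine Finset.sum_eq_zero fun i _ => Finset.sum_eq_zero fun j _ => if_neg ?_
            rintro rfl
            exact h (Finset.add_mem_add (Finset.mem_image_of_mem _ (Finset.mem_univ i))
              (Finset.mem_image_of_mem _ (Finset.mem_univ j)))
          simp [this]
    _ ≤ _ := by
        rw [← Finset.sum_filter, Finset.sum_const, nsmul_eq_mul, mul_one]
        exact_mod_cast Finset.card_le_card fun s hs => (Finset.mem_filter.1 hs).2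

end SumRep

section Fourier

open scoped BigOperators ComplexConjugate

variable {G : Type*} [AddCommGroup G] [Fintype G]

/-- The sum of the values of a character over a finite set. -/
noncomputable def charSum (B : Finset G) (χ : AddChar G ℂ) : ℂ := ∑ b ∈ B, χ b

lemma sum_norm_sq_sum_addChar (F : AddChar G ℂ → ℂ) :
    ∑ s, ‖∑ χ, F χ * χ (-s)‖ ^ 2 = Fintype.card G * ∑ χ, ‖F χ‖ ^ 2 := by
  rw [← Complex.ofReal_inj]
  push_cast
  simp only [← Complex.mul_conj', map_sum, map_mul, ← AddChar.map_neg_eq_conj, neg_neg,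
    Finset.sum_mul_sum]
  rw [Finset.sum_comm, Finset.mul_sum]
  refine Finset.sum_congr rfl fun χ _ => ?_
  rw [Finset.sum_comm]
  have h : ∀ ψ : AddChar G ℂ, ∑ s, F χ * χ (-s) * (conj (F ψ) * ψ s) =
      if ψ = χ then Fintype.card G * (F χ * conj (F χ)) else 0 := by
    intro ψ
    have h1 : ∀ s, F χ * χ (-s) * (conj (F ψ) * ψ s) = F χ * conj (F ψ) * (ψ - χ) s := by
      intro s
      rw [AddChar.sub_apply]; ring
    simp only [h1]
    rw [← Finset.mul_sum, AddChar.sum_eq_ite]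
    simp only [sub_eq_zero]
    split_ifs with h
    · rw [h]; ring
    · simp
  simp only [h, Finset.sum_ite_eq', Finset.mem_univ, if_true]

lemma sum_norm_charSum_sq (B : Finset G) :
    ∑ χ, ‖charSum B χ‖ ^ 2 = Fintype.card G * B.card := by
  rw [← Complex.ofReal_inj]
  push_cast
  simp only [← Complex.mul_conj', charSum, map_sum, ← AddChar.map_neg_eq_conj,
    Finset.sum_mul_sum, ← AddChar.map_add_eq_mul]
  rw [Finset.sum_comm]
  have h : ∀ b ∈ B, ∑ χ : AddChar G ℂ, ∑ j ∈ B, χ (b + -j) = Fintype.card G := by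
    intro b hb
    rw [Finset.sum_comm]
    simp only [AddChar.sum_apply_eq_ite, ← sub_eq_add_neg, sub_eq_zero, Finset.sum_ite_eq,
      if_pos hb]
  rw [Finset.sum_congr rfl h, Finset.sum_const, nsmul_eq_mul, mul_comm]

lemma abs_sign_mul_re_or_im_le (b b' : Bool) {z : ℂ} (hz : ‖z‖ ≤ 1) :
    |(if b then 1 else -1) * (if b' then z.re else z.im)| ≤ 1 := by
  have h1 := Complex.abs_re_le_norm z
  have h2 := Complex.abs_im_le_norm z
  cases b <;> cases b' <;> simp <;> linarith

lemma norm_le_of_sign_mul_re_or_im_le {z : ℂ} {t : ℝ}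
    (h : ∀ b b' : Bool, (if b then 1 else -1) * (if b' then z.re else z.im) ≤ t) :
    ‖z‖ ≤ 2 * t := by
  have h1 := h true true
  have h2 := h false true
  have h3 := h true false
  have h4 := h false false
  simp at h1 h2 h3 h4
  have h5 : |z.re| ≤ t := abs_le.2 ⟨by linarith, h1⟩
  have h6 : |z.im| ≤ t := abs_le.2 ⟨by linarith, h3⟩
  linarith [Complex.norm_le_abs_re_add_abs_im z]

/-- The Fourier transform of a set is uniformly approximated by that of a small random sample. -/
lemma exists_charSum_sample {B : Finset G} (hB : B.Nonempty) {k : ℕ} (hk0 : 0 < k) {ε : ℝ}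
    (hε0 : 0 < ε) (hε1 : ε ≤ 1)
    (hk : 4 * (Fintype.card G : ℝ) * Real.exp (-(ε ^ 2 * k / 64)) < 1) :
    ∃ a : Fin k → G, (∀ i, a i ∈ B) ∧
      ∀ χ : AddChar G ℂ, ‖(B.card / k : ℝ) * ∑ i, χ (a i) - charSum B χ‖ ≤ ε * B.card := by
  have : Nonempty B := hB.to_subtype
  have hm : (0 : ℝ) < B.card := by exact_mod_cast Finset.card_pos.2 hB
  have hk' : (0 : ℝ) < k := by exact_mod_cast hk0
  obtain ⟨a, ha⟩ := exists_sample (Ω := B) (J := AddChar G ℂ × Bool × Bool) (k := k)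
    (fun j x => (if j.2.1 then 1 else -1) * (if j.2.2 then (j.1 x).re else (j.1 x).im))
    (fun j x => abs_sign_mul_re_or_im_le _ _ (j.1.norm_apply _).le) (η := ε / 2)
    (by linarith) (by linarith) (by
      convert hk using 2
      · simp [AddChar.card_eq]; ring
      · congr 1; ring)
  refine ⟨fun i => a i, fun i => (a i).2, fun χ => ?_⟩
  have key : ‖∑ i, χ (a i) - (k / B.card : ℝ) * charSum B χ‖ ≤ 2 * (ε / 2 * k) := by
    refine norm_le_of_sign_mul_re_or_im_le fun b b' => ?_
    have h1 := ha (χ, b, b')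
    rw [Fintype.expect_eq_sum_div_card, Finset.sum_coe_sort B fun x : G =>
      ((if b then 1 else -1) * (if b' then (χ x).re else (χ x).im) : ℝ), Fintype.card_coe] at h1
    refine le_trans (le_of_eq ?_) h1
    rw [← Finset.mul_sum, ← Finset.mul_sum]
    cases b <;> cases b' <;> simp [charSum] <;> ring
  have h2 : ((B.card / k : ℝ) : ℂ) * ∑ i, χ (a i) - charSum B χ =
      (B.card / k : ℝ) * (∑ i, χ (a i) - (k / B.card : ℝ) * charSum B χ) := by
    rw [mul_sub, ← mul_assoc, ← Complex.ofReal_mul, div_mul_div_comm, mul_comm (k : ℝ), div_self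
      (by positivity)]
    simp
  rw [h2, norm_mul, Complex.norm_real, Real.norm_of_nonneg (by positivity)]
  calc _ ≤ (B.card / k : ℝ) * (2 * (ε / 2 * k)) := by gcongr
    _ = _ := by field_simp

variable [DecidableEq G]

lemma sum_charSum_sq_mul (B : Finset G) (s : G) :
    ∑ χ, charSum B χ ^ 2 * χ (-s) = ((Fintype.card G * sumRep B s : ℝ) : ℂ) := by
  unfold charSum sumRep
  simp only [sq, Finset.sum_mul_sum]
  simp only [Finset.sum_mul, ← AddChar.map_add_eq_mul]
  rw [Finset.sum_comm]
  push_cast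
  rw [Finset.mul_sum]
  refine Finset.sum_congr rfl fun x _ => ?_
  rw [Finset.sum_comm, Finset.mul_sum]
  refine Finset.sum_congr rfl fun y _ => ?_
  rw [AddChar.sum_apply_eq_ite]
  simp only [← sub_eq_add_neg, sub_eq_zero]
  split_ifs <;> simp

/-- The elements where the truncated inverse Fourier transform of `α ^ 2` is at least `τ / 2`;
if `α` approximates the Fourier transform of a set `B` then this approximates the set of elements
with at least `τ` representations as a sum of two elements of `B`. -/
noncomputable def popularSet (δ τ : ℝ) (α : AddChar G ℂ → ℂ) : Finset G :=
  {s | Fintype.card G * (τ / 2) ≤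
    (∑ χ, (if 2 * δ ≤ ‖α χ‖ then α χ ^ 2 else 0) * χ (-s)).re}

lemma norm_sq_sub_truncated_le {δ : ℝ} {a b : ℂ} (h : ‖a - b‖ ≤ δ) :
    ‖b ^ 2 - (if 2 * δ ≤ ‖a‖ then a ^ 2 else 0)‖ ≤ 3 * δ * ‖b‖ := by
  have hδ : 0 ≤ δ := (norm_nonneg _).trans h
  have h1 := norm_sub_norm_le a b
  have h2 := norm_sub_norm_le b a
  rw [norm_sub_rev] at h2
  split_ifs with h0
  · have h3 : b ^ 2 - a ^ 2 = (b - a) * (2 * b + (a - b)) := by ring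
    have h4 : ‖2 * b + (a - b)‖ ≤ 3 * ‖b‖ := by
      have := norm_add_le (2 * b) (a - b)
      rw [norm_mul, Complex.norm_ofNat] at this
      linarith
    rw [h3, norm_mul, norm_sub_rev]
    calc _ ≤ δ * (3 * ‖b‖) := mul_le_mul h h4 (norm_nonneg _) hδ
      _ = _ := by ring
  · rw [sub_zero, norm_pow, sq]
    exact mul_le_mul_of_nonneg_right (by linarith) (norm_nonneg _)

lemma exists_error_popularSet {B : Finset G} {δ : ℝ} {α : AddChar G ℂ → ℂ}
    (hα : ∀ χ, ‖α χ - charSum B χ‖ ≤ δ) (τ : ℝ) :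
    ∃ e : G → ℝ, ∑ s, e s ^ 2 ≤ 9 * δ ^ 2 * B.card ∧
      (∀ s, s ∈ popularSet δ τ α ↔ τ / 2 ≤ sumRep B s - e s) := by
  have hn : (0 : ℝ) < Fintype.card G := by exact_mod_cast Fintype.card_pos
  set γ : AddChar G ℂ → ℂ := fun χ => if 2 * δ ≤ ‖α χ‖ then α χ ^ 2 else 0 with hγ
  refine ⟨fun s => (∑ χ, (charSum B χ ^ 2 - γ χ) * χ (-s)).re / Fintype.card G, ?_, fun s => ?_⟩
  · have h1 : ∀ s : G, ((∑ χ, (charSum B χ ^ 2 - γ χ) * χ (-s)).re / Fintype.card G) ^ 2 ≤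
        ‖∑ χ, (charSum B χ ^ 2 - γ χ) * χ (-s)‖ ^ 2 / (Fintype.card G : ℝ) ^ 2 := fun s => by
      rw [div_pow]
      refine div_le_div_of_nonneg_right ?_ (sq_nonneg _)
      rw [← sq_abs]
      exact pow_le_pow_left₀ (abs_nonneg _) (Complex.abs_re_le_norm _) 2
    refine (Finset.sum_le_sum fun s _ => h1 s).trans ?_
    rw [← Finset.sum_div, sum_norm_sq_sum_addChar, div_le_iff₀ (by positivity)]
    calc _ ≤ (Fintype.card G : ℝ) * ∑ χ, 9 * δ ^ 2 * ‖charSum B χ‖ ^ 2 := by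
          refine mul_le_mul_of_nonneg_left (Finset.sum_le_sum fun χ _ => ?_) hn.le
          refine (pow_le_pow_left₀ (norm_nonneg _) (norm_sq_sub_truncated_le (hα χ)) 2).trans_eq ?_
          ring
      _ = _ := by
          rw [← Finset.mul_sum, sum_norm_charSum_sq]; ring
  · have h2 : (∑ χ, (charSum B χ ^ 2 - γ χ) * χ (-s)).re =
        Fintype.card G * sumRep B s - (∑ χ, γ χ * χ (-s)).re := by
      simp only [sub_mul, Finset.sum_sub_distrib]
      rw [sum_charSum_sq_mul, Complex.sub_re, Complex.ofReal_re]
    simp only [popularSet, Finset.mem_filter, Finset.mem_univ, true_and]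
    rw [h2]
    change _ ≤ (∑ χ, γ χ * χ (-s)).re ↔ _
    have h3 : sumRep B s - (Fintype.card G * sumRep B s - (∑ χ, γ χ * χ (-s)).re) /
        Fintype.card G = (∑ χ, γ χ * χ (-s)).re / Fintype.card G := by
      field_simp; ring
    rw [h3, le_div_iff₀ hn, mul_comm]

lemma card_popularSet_le {B : Finset G} {δ τ : ℝ} (hτ : 0 < τ) {α : AddChar G ℂ → ℂ}
    (hα : ∀ χ, ‖α χ - charSum B χ‖ ≤ δ) :
    ((popularSet δ τ α).card : ℝ) ≤ 4 * B.card ^ 2 / τ + 144 * δ ^ 2 * B.card / τ ^ 2 := by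
  obtain ⟨e, he, hmem⟩ := exists_error_popularSet hα τ
  calc ((popularSet δ τ α).card : ℝ) = ∑ s ∈ popularSet δ τ α, (1 : ℝ) := by simp
    _ ≤ ∑ s ∈ popularSet δ τ α, (4 / τ * sumRep B s + 16 / τ ^ 2 * e s ^ 2) := by
        refine Finset.sum_le_sum fun s hs => ?_
        have h1 := (hmem s).1 hs
        have h2 := sumRep_nonneg B s
        rcases le_or_gt (τ / 4) (sumRep B s) with h | h
        · have : 1 ≤ 4 / τ * sumRep B s := by
            rw [div_mul_eq_mul_div, one_le_div hτ]; linarith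
          have : 0 ≤ 16 / τ ^ 2 * e s ^ 2 := by positivity
          linarith
        · have : 1 ≤ 16 / τ ^ 2 * e s ^ 2 := by
            rw [div_mul_eq_mul_div, one_le_div (by positivity)]
            nlinarith
          have : 0 ≤ 4 / τ * sumRep B s := by positivity
          linarith
    _ ≤ ∑ s, (4 / τ * sumRep B s + 16 / τ ^ 2 * e s ^ 2) := by
        refine Finset.sum_le_sum_of_subset_of_nonneg (Finset.subset_univ _) fun s _ _ => ?_
        have := sumRep_nonneg B s
        positivity
    _ ≤ _ := by
        rw [Finset.sum_add_distrib, ← Finset.mul_sum, ← Finset.mul_sum, sum_sumRep]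
        have : 16 / τ ^ 2 * ∑ s, e s ^ 2 ≤ 16 / τ ^ 2 * (9 * δ ^ 2 * B.card) := by gcongr
        calc _ ≤ 4 / τ * (B.card : ℝ) ^ 2 + 16 / τ ^ 2 * (9 * δ ^ 2 * B.card) := by linarith
          _ = _ := by ring

lemma sum_sumRep_sdiff_popularSet_le {B P : Finset G} {δ τ : ℝ} (hτ : 0 < τ)
    {α : AddChar G ℂ → ℂ} (hα : ∀ χ, ‖α χ - charSum B χ‖ ≤ δ) (hP : ∀ s ∈ P, τ ≤ sumRep B s) :
    ∑ s ∈ P \ popularSet δ τ α, sumRep B s ≤ 36 * δ ^ 2 * B.card / τ := by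
  obtain ⟨e, he, hmem⟩ := exists_error_popularSet hα τ
  calc _ ≤ ∑ s ∈ P \ popularSet δ τ α, 4 / τ * e s ^ 2 := by
        refine Finset.sum_le_sum fun s hs => ?_
        obtain ⟨hs1, hs2⟩ := Finset.mem_sdiff.1 hs
        have h1 := hP s hs1
        rw [hmem, not_le] at hs2
        rw [div_mul_eq_mul_div, le_div_iff₀ hτ]
        have h2 : sumRep B s / 2 ≤ e s := by linarith
        nlinarith
    _ ≤ ∑ s, 4 / τ * e s ^ 2 :=
        Finset.sum_le_sum_of_subset_of_nonneg (Finset.subset_univ _) fun s _ _ => by positivity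
    _ ≤ 4 / τ * (9 * δ ^ 2 * B.card) := by
        rw [← Finset.mul_sum]; gcongr
    _ = _ := by ring

end Fourier

section Concentration

variable {G : Type*} [AddCommGroup G] [Fintype G] [DecidableEq G]

lemma bernoulliProb_exists_char_le {p : ℝ} (hp0 : 0 ≤ p) (hp1 : p ≤ 1) {Q : Finset G} {m N : ℝ}
    (hm : 0 ≤ m) (hN : 0 < N) (hQ : (Q.card : ℝ) ≤ N) (hmN : m ≤ 32 * N) :
    bernoulliProb p Finset.univ (fun S => ∃ χ : AddChar G ℂ,
        p * m / 8 < ‖∑ s ∈ Q, ((p - if s ∈ S then 1 else 0 : ℝ) : ℂ) * χ (-s)‖) ≤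
      4 * Fintype.card G * Real.exp (-(p * m ^ 2 / (1024 * N))) := by
  calc _ ≤ bernoulliProb p Finset.univ (fun S =>
          ∃ j ∈ (Finset.univ : Finset (AddChar G ℂ × Bool × Bool)),
            p * m / 16 ≤ ∑ s ∈ Q, (p - if s ∈ S then 1 else 0) *
              ((if j.2.1 then 1 else -1) *
                (if j.2.2 then (j.1 (-s)).re else (j.1 (-s)).im))) := by
        refine bernoulliProb_mono hp0 hp1 fun S _ ⟨χ, hχ⟩ => ?_
        by_contra! h
        refine hχ.not_ge ((norm_le_of_sign_mul_re_or_im_le (t := p * m / 16)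
          fun b b' => ?_).trans_eq (by ring))
        refine le_trans (le_of_eq ?_) (h (χ, b, b') (Finset.mem_univ _)).le
        cases b <;> cases b' <;> simp [Finset.mul_sum]
    _ ≤ ∑ j : AddChar G ℂ × Bool × Bool, Real.exp (-(p * m ^ 2 / (1024 * N))) := by
        refine (bernoulliProb_exists_le hp0 hp1 _ _ _).trans (Finset.sum_le_sum fun j _ => ?_)
        refine (bernoulliProb_le_sum_le hp0 hp1 (Finset.subset_univ Q) _
          (fun s _ => abs_sign_mul_re_or_im_le _ _ (j.1.norm_apply _).le)
          (l := m / (32 * N)) (by positivity) ((div_le_one (by positivity)).2 hmN)).trans ?_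
        rw [Real.exp_le_exp]
        have h1 : p * (m / (32 * N)) ^ 2 * Q.card ≤ p * (m / (32 * N)) ^ 2 * N := by gcongr
        refine (sub_le_sub_right h1 _).trans_eq ?_
        field_simp
        ring
    _ = _ := by
        simp [AddChar.card_eq]; ring

lemma sum_mul_sumRep_le (B : Finset G) (Q : Finset G) (d : G → ℝ) {δ : ℝ}
    (h : ∀ χ : AddChar G ℂ, ‖∑ s ∈ Q, (d s : ℂ) * χ (-s)‖ ≤ δ) :
    ∑ s ∈ Q, d s * sumRep B s ≤ δ * B.card := by
  have hn : (0 : ℝ) < Fintype.card G := by exact_mod_cast Fintype.card_pos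
  have h1 : ((Fintype.card G * ∑ s ∈ Q, d s * sumRep B s : ℝ) : ℂ) =
      ∑ χ : AddChar G ℂ, charSum B χ ^ 2 * ∑ s ∈ Q, (d s : ℂ) * χ (-s) := by
    simp only [Finset.mul_sum]
    rw [Finset.sum_comm]
    push_cast
    refine Finset.sum_congr rfl fun s _ => ?_
    have h2 := sum_charSum_sq_mul B s
    push_cast at h2
    rw [mul_left_comm, ← h2, Finset.mul_sum]
    exact Finset.sum_congr rfl fun χ _ => by ring
  rw [← mul_le_mul_iff_of_pos_left hn]
  calc _ ≤ |(Fintype.card G * ∑ s ∈ Q, d s * sumRep B s : ℝ)| := le_abs_self _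
    _ = ‖∑ χ : AddChar G ℂ, charSum B χ ^ 2 * ∑ s ∈ Q, (d s : ℂ) * χ (-s)‖ := by
        rw [← h1, Complex.norm_real, Real.norm_eq_abs]
    _ ≤ ∑ χ : AddChar G ℂ, ‖charSum B χ‖ ^ 2 * δ := by
        refine (norm_sum_le _ _).trans (Finset.sum_le_sum fun χ _ => ?_)
        rw [norm_mul, norm_pow]
        exact mul_le_mul_of_nonneg_left (h χ) (sq_nonneg _)
    _ = _ := by rw [← Finset.sum_mul, sum_norm_charSum_sq]; ring

/-- For a fixed not too large set `Q`, it is very unlikely that there is an independent set of size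
`m` whose sums are concentrated on `Q`. -/
lemma bernoulliProb_exists_independent_le {p : ℝ} (hp0 : 0 < p) (hp : p ≤ 1 / 2) {Q : Finset G}
    {m : ℕ} {N : ℝ} (hm : 0 < m) (hN : 0 < N) (hQ : (Q.card : ℝ) ≤ N) (hmN : m ≤ 32 * N)
    (hlarge : 4 * Fintype.card G * Real.exp (-(p * m ^ 2 / (1024 * N))) ≤ 1 / 2) :
    bernoulliProb p Finset.univ (fun S => ∃ B : Finset G, B.card = m ∧
        (m : ℝ) ^ 2 / 4 ≤ ∑ s ∈ Q, sumRep B s ∧ (B + B) ∩ S = ∅) ≤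
      2 * Real.exp (-(p * m / 512)) := by
  have hp1 : p ≤ 1 := by linarith
  have hm0 : (0 : ℝ) < m := by exact_mod_cast hm
  set 𝓑 : Finset (Finset G) := {B | B.card = m ∧ (m : ℝ) ^ 2 / 4 ≤ ∑ s ∈ Q, sumRep B s} with h𝓑
  have hmem : ∀ B, B ∈ 𝓑 ↔ B.card = m ∧ (m : ℝ) ^ 2 / 4 ≤ ∑ s ∈ Q, sumRep B s := by simp [h𝓑]
  rcases 𝓑.eq_empty_or_nonempty with hemp | hne
  · refine (bernoulliProb_le_exp hp0.le hp1 (f := fun _ => 0) (fun _ => le_rfl)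
      fun S _ ⟨B, h1, h2, _⟩ => ?_).trans ?_
    · rw [bernoulliExp_const]; positivity
    · have : B ∈ 𝓑 := (hmem B).2 ⟨h1, h2⟩
      simp [hemp] at this
  set W : Finset G → Finset G → ℝ := fun S B => ∑ s ∈ Q, if s ∈ S then sumRep B s else 0 with hW
  set Z : Finset G → ℝ := fun S => 𝓑.inf' hne (W S) with hZ
  set l : ℝ := 1 / (32 * m) with hl
  have hl0 : 0 < l := by positivity
  obtain ⟨q, hq, hq'⟩ := exists_infConvolution hp0 hp Finset.univ (fun S : Finset G => -(l * Z S))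
  have hZlow : Real.exp (p * m / 256) / 2 ≤
      bernoulliExp p Finset.univ (fun S : Finset G => Real.exp (-(-(l * Z S)))) := by
    have h1 : 1 / 2 ≤ bernoulliProb p Finset.univ (fun S => ¬ ∃ χ : AddChar G ℂ,
        p * m / 8 < ‖∑ s ∈ Q, ((p - if s ∈ S then 1 else 0 : ℝ) : ℂ) * χ (-s)‖) := by
      rw [bernoulliProb_not]
      have := bernoulliProb_exists_char_le hp0.le hp1 hm0.le hN hQ hmN
      linarith
    have h2 : bernoulliProb p Finset.univ (fun S => ¬ ∃ χ : AddChar G ℂ,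
        p * m / 8 < ‖∑ s ∈ Q, ((p - if s ∈ S then 1 else 0 : ℝ) : ℂ) * χ (-s)‖) ≤
        bernoulliExp p Finset.univ (fun S : Finset G =>
          Real.exp (-(p * m / 256)) * Real.exp (-(-(l * Z S)))) := by
      refine bernoulliProb_le_exp hp0.le hp1 (fun S => by positivity) fun S _ hS => ?_
      push Not at hS
      rw [← Real.exp_add]
      refine Real.one_le_exp ?_
      have h3 : p * m ^ 2 / 8 ≤ Z S := by
        refine Finset.le_inf' _ _ fun B hB => ?_
        obtain ⟨hB1, hB2⟩ := (hmem B).1 hB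
        have h4 := sum_mul_sumRep_le B Q (fun s => p - if s ∈ S then 1 else 0) hS
        simp only [sub_mul, ite_mul, one_mul, zero_mul, Finset.sum_sub_distrib,
          ← Finset.mul_sum] at h4
        rw [hB1] at h4
        have h5 := mul_le_mul_of_nonneg_left hB2 hp0.le
        simp only [hW]
        nlinarith
      have h6 := mul_le_mul_of_nonneg_left h3 hl0.le
      have h7 : l * (p * m ^ 2 / 8) = p * m / 256 := by
        rw [hl]; field_simp; norm_num
      linarith
    rw [bernoulliExp_mul_left, Real.exp_neg] at h2
    have h8 := h1.trans h2
    rw [inv_mul_eq_div, le_div_iff₀ (Real.exp_pos _)] at h8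
    linarith
  have hEq : bernoulliExp p Finset.univ (fun S => Real.exp (q S)) ≤
      2 * Real.exp (-(p * m / 256)) := by
    have hpos : 0 < bernoulliExp p Finset.univ (fun S => Real.exp (q S)) :=
      bernoulliExp_pos hp0.le hp1 _ fun S => Real.exp_pos _
    have h1 := (mul_le_mul_of_nonneg_left hZlow hpos.le).trans hq
    rw [Real.exp_neg, ← div_eq_mul_inv, le_div_iff₀ (Real.exp_pos _)]
    linarith
  calc _ ≤ bernoulliExp p Finset.univ (fun S => Real.exp (p * m / 512) * Real.exp (q S)) := by
        refine bernoulliProb_le_exp hp0.le hp1 (fun S => by positivity)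
          fun S _ ⟨B, hB1, hB2, hB3⟩ => ?_
        have hBm : B ∈ 𝓑 := (hmem B).2 ⟨hB1, hB2⟩
        have hlm : l * m = 1 / 32 := by rw [hl]; field_simp
        have hr : ∀ s, sumRep B s ≤ m := fun s => hB1 ▸ sumRep_le B s
        have h1 := hq' S (Finset.subset_univ S) (fun s => if s ∈ Q then l * sumRep B s else 0)
          (fun s => by
            have h2 := sumRep_nonneg B s
            have h3 := mul_le_mul_of_nonneg_left (hr s) hl0.le
            split_ifs
            · exact ⟨by positivity, by linarith⟩
            · norm_num) 0 (fun S' _ => by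
            have h4 : Z S' ≤ W S' B := Finset.inf'_le _ hBm
            have h5 : ∑ s ∈ S' \ S, (if s ∈ Q then l * sumRep B s else 0) = l * W S' B := by
              rw [hW, Finset.mul_sum, Finset.sum_ite_mem]
              simp only [mul_ite, mul_zero]
              rw [Finset.sum_ite_mem]
              refine Finset.sum_subset_zero_on_sdiff ?_ ?_ fun _ _ => rfl
              · intro s; simp only [Finset.mem_inter, Finset.mem_sdiff]; tauto
              · intro s hs
                have h6 : s ∈ S := by
                  simp only [Finset.mem_inter, Finset.mem_sdiff] at hs; tauto
                rw [sumRep_eq_zero_of_notMem fun h7 => ?_, mul_zero]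
                simpa [hB3] using Finset.mem_inter.2 ⟨h7, h6⟩
            rw [h5]
            nlinarith)
        have h8 : ∑ s, (if s ∈ Q then l * sumRep B s else 0) ^ 2 ≤ l ^ 2 * m ^ 3 := by
          calc _ ≤ ∑ s, l ^ 2 * m * sumRep B s := by
                refine Finset.sum_le_sum fun s _ => ?_
                have h2 := sumRep_nonneg B s
                split_ifs
                · rw [mul_pow, mul_assoc, sq (sumRep B s)]
                  have := hr s
                  gcongr
                · rw [zero_pow two_ne_zero]; positivity
            _ = _ := by rw [← Finset.mul_sum, sum_sumRep, hB1]; ring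
        have h9 : l ^ 2 * (m : ℝ) ^ 3 = m / 1024 := by
          rw [hl]; field_simp; norm_num
        rw [← Real.exp_add]
        refine Real.one_le_exp ?_
        have h10 := mul_le_mul_of_nonneg_left h8 (by positivity : 0 ≤ 2 * p)
        rw [h9] at h10
        linarith
    _ ≤ Real.exp (p * m / 512) * (2 * Real.exp (-(p * m / 256))) := by
        rw [bernoulliExp_mul_left]; gcongr
    _ = _ := by
        rw [mul_left_comm, ← Real.exp_add]; congr 2; ring

end Concentration

section Assembly

variable {G : Type*} [AddCommGroup G] [Fintype G] [DecidableEq G]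

/-- The popular set read off from a sample `a`, normalised for sets of size `m`. -/
noncomputable def samplePopularSet (m : ℕ) {k : ℕ} (δ τ : ℝ) (a : Fin k → G) : Finset G :=
  popularSet δ τ fun χ => (m / k : ℝ) * ∑ i, χ (a i)

/-- Every set `B` of size `m` either contains two small samples with a large sumset, or has its sums
concentrated on one of few small sets. -/
lemma sumset_dichotomy {B : Finset G} {m k₁ k₂ : ℕ} (hB : B.card = m) (hk₁ : 0 < k₁)
    (hk₂ : 0 < k₂) (hk₁m : 4 * k₁ ≤ m) (hmk₁ : (m : ℝ) ≤ 288 * k₁ ^ 2)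
    (hn : 4 * (Fintype.card G : ℝ) * Real.exp (-(m / (288 * k₁ ^ 2) * k₂ / 64)) < 1) :
    (∃ a a' : Fin k₁ → G, (∀ i, a i ∈ B) ∧ (∀ i, a' i ∈ B) ∧
      (k₁ : ℝ) ^ 2 / 4 ≤ ((Finset.univ.image a + Finset.univ.image a').card : ℝ)) ∨
    ∃ a : Fin k₂ → G,
      ((samplePopularSet m (√(m / (288 * k₁ ^ 2)) * m) (m ^ 2 / (2 * k₁ ^ 2)) a).card : ℝ) ≤
        10 * k₁ ^ 2 ∧
      (m : ℝ) ^ 2 / 4 ≤ ∑ s ∈ samplePopularSet m (√(m / (288 * k₁ ^ 2)) * m)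
        (m ^ 2 / (2 * k₁ ^ 2)) a, sumRep B s := by
  have hm : (0 : ℝ) < m := by
    have : 0 < m := by omega
    exact_mod_cast this
  have hk : (0 : ℝ) < k₁ := by exact_mod_cast hk₁
  have hBne : B.Nonempty := Finset.card_pos.1 (by omega)
  set τ : ℝ := m ^ 2 / (2 * k₁ ^ 2) with hτ
  have hτ0 : 0 < τ := by positivity
  set T : Finset G := {s | sumRep B s ≤ τ} with hT
  set P : Finset G := {s | ¬ sumRep B s ≤ τ} with hP
  have hTP : ∑ s ∈ T, sumRep B s + ∑ s ∈ P, sumRep B s = (m : ℝ) ^ 2 := by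
    rw [hT, hP, Finset.sum_filter_add_sum_filter_not, sum_sumRep, hB]
  rcases le_total ((m : ℝ) ^ 2 / 2) (∑ s ∈ T, sumRep B s) with h | h
  · left
    refine exists_large_sumset (T := T) hk₁ (by omega) (fun s hs => ?_) (by rwa [hB])
    have h1 : sumRep B s ≤ τ := (Finset.mem_filter.1 hs).2
    rw [hτ, le_div_iff₀ (by positivity)] at h1
    rw [hB]; linarith
  · right
    set ε : ℝ := √(m / (288 * k₁ ^ 2)) with hε
    have hε0 : 0 < ε := Real.sqrt_pos.2 (by positivity)
    have hεsq : ε ^ 2 = m / (288 * k₁ ^ 2) := Real.sq_sqrt (by positivity)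
    have hε1 : ε ≤ 1 := by
      refine Real.sqrt_le_iff.2 ⟨zero_le_one, ?_⟩
      rw [one_pow, div_le_one (by positivity)]
      exact hmk₁
    obtain ⟨a, -, ha⟩ := exists_charSum_sample hBne hk₂ hε0 hε1 (by rw [hεsq]; exact hn)
    rw [hB] at ha
    refine ⟨a, ?_, ?_⟩
    · refine (card_popularSet_le hτ0 ha).trans_eq ?_
      rw [mul_pow, hεsq, hτ, hB]
      field_simp
      norm_num
    · have h1 := sum_sumRep_sdiff_popularSet_le (P := P) hτ0 ha fun s hs =>
        (not_le.1 (Finset.mem_filter.1 hs).2).le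
      have h2 : 36 * (ε * m) ^ 2 * (B.card : ℝ) / τ = m ^ 2 / 4 := by
        rw [mul_pow, hεsq, hτ, hB]
        field_simp
        norm_num
      rw [h2] at h1
      set Q := samplePopularSet m (ε * m) τ a with hQ
      have h3 : ∑ s ∈ P, sumRep B s ≤ ∑ s ∈ P \ Q, sumRep B s + ∑ s ∈ Q, sumRep B s := by
        rw [← Finset.sum_union Finset.sdiff_disjoint]
        refine Finset.sum_le_sum_of_subset_of_nonneg ?_ fun s _ _ => sumRep_nonneg B s
        rw [Finset.sdiff_union_self_eq_union]
        exact Finset.subset_union_left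
      have h4 : ∑ s ∈ P \ Q, sumRep B s ≤ (m : ℝ) ^ 2 / 4 := h1
      linarith

lemma bernoulliProb_exists_independent_card_eq_le {p : ℝ} (hp0 : 0 < p) (hp : p ≤ 1 / 2)
    {m k₁ k₂ : ℕ} (hk₁ : 0 < k₁) (hk₂ : 0 < k₂) (hk₁m : 4 * k₁ ≤ m)
    (hmk₁ : (m : ℝ) ≤ 288 * k₁ ^ 2)
    (hn : 4 * (Fintype.card G : ℝ) * Real.exp (-(m / (288 * k₁ ^ 2) * k₂ / 64)) < 1)
    (hn' : 4 * (Fintype.card G : ℝ) * Real.exp (-(p * m ^ 2 / (10240 * k₁ ^ 2))) ≤ 1 / 2) :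
    bernoulliProb p Finset.univ (fun S : Finset G => ∃ B : Finset G, B.card = m ∧
        (B + B) ∩ S = ∅) ≤
      (Fintype.card G : ℝ) ^ (2 * k₁) * Real.exp (-(p * k₁ ^ 2 / 4)) +
        (Fintype.card G : ℝ) ^ k₂ * (2 * Real.exp (-(p * m / 512))) := by
  have hp1 : p ≤ 1 := by linarith
  have hk : (0 : ℝ) < k₁ := by exact_mod_cast hk₁
  set Q : (Fin k₂ → G) → Finset G := fun a =>
    samplePopularSet m (√(m / (288 * k₁ ^ 2)) * m) (m ^ 2 / (2 * k₁ ^ 2)) a with hQ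
  set I : Finset ((Fin k₁ → G) × (Fin k₁ → G)) :=
    {z | (k₁ : ℝ) ^ 2 / 4 ≤ ((Finset.univ.image z.1 + Finset.univ.image z.2).card : ℝ)} with hI
  set J : Finset (Fin k₂ → G) := {a | ((Q a).card : ℝ) ≤ 10 * k₁ ^ 2} with hJ
  calc _ ≤ bernoulliProb p Finset.univ (fun S =>
          (∃ z ∈ I, (Finset.univ.image z.1 + Finset.univ.image z.2) ∩ S = ∅) ∨
          ∃ a ∈ J, ∃ B : Finset G, B.card = m ∧
            (m : ℝ) ^ 2 / 4 ≤ ∑ s ∈ Q a, sumRep B s ∧ (B + B) ∩ S = ∅) := by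
        refine bernoulliProb_mono hp0.le hp1 fun S _ ⟨B, hB, hBS⟩ => ?_
        rcases sumset_dichotomy hB hk₁ hk₂ hk₁m hmk₁ hn with ⟨a, a', ha, ha', h⟩ | ⟨a, ha, h⟩
        · refine Or.inl ⟨(a, a'), Finset.mem_filter.2 ⟨Finset.mem_univ _, h⟩, ?_⟩
          rw [← Finset.subset_empty, ← hBS]
          refine Finset.inter_subset_inter_right (Finset.add_subset_add ?_ ?_)
          · simpa [Finset.subset_iff] using ha
          · simpa [Finset.subset_iff] using ha'
        · exact Or.inr ⟨a, Finset.mem_filter.2 ⟨Finset.mem_univ _, ha⟩, B, hB, h, hBS⟩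
    _ ≤ _ := by
        refine (bernoulliProb_or_le hp0.le hp1 _ _ _).trans (add_le_add ?_ ?_)
        · refine (bernoulliProb_exists_le hp0.le hp1 _ _ _).trans ?_
          calc _ ≤ ∑ z ∈ I, Real.exp (-(p * k₁ ^ 2 / 4)) := by
                refine Finset.sum_le_sum fun z hz => ?_
                refine (bernoulliProb_inter_eq_empty_le hp0.le hp1
                  (Finset.subset_univ _)).trans (Real.exp_le_exp.2 ?_)
                have := mul_le_mul_of_nonneg_left (Finset.mem_filter.1 hz).2 hp0.le
                linarith
            _ ≤ _ := by
                rw [Finset.sum_const, nsmul_eq_mul]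
                refine mul_le_mul_of_nonneg_right ?_ (Real.exp_pos _).le
                refine (Nat.cast_le.2 (Finset.card_le_univ I)).trans_eq ?_
                simp [two_mul, pow_add]
        · refine (bernoulliProb_exists_le hp0.le hp1 _ _ _).trans ?_
          calc _ ≤ ∑ a ∈ J, 2 * Real.exp (-(p * m / 512)) := by
                refine Finset.sum_le_sum fun a ha => ?_
                refine bernoulliProb_exists_independent_le hp0 hp (by omega)
                  (N := 10 * k₁ ^ 2) (by positivity) (Finset.mem_filter.1 ha).2 (by nlinarith) ?_
                rw [show (1024 : ℝ) * (10 * (k₁ : ℝ) ^ 2) = 10240 * (k₁ : ℝ) ^ 2 by ring]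
                exact hn'
            _ ≤ _ := by
                rw [Finset.sum_const, nsmul_eq_mul]
                refine mul_le_mul_of_nonneg_right ?_ (by positivity)
                refine (Nat.cast_le.2 (Finset.card_le_univ J)).trans_eq ?_
                simp

lemma exists_sample_sizes {x y : ℝ} {m : ℕ} (hx0 : 0 < x) (hx1 : x ≤ 1) (hy : 1 / 2 ≤ y)
    (hm : 2 ^ 60 * y ^ 19 ≤ m * x ^ 3) :
    ∃ k₁ k₂ : ℕ, 0 < k₁ ∧ 0 < k₂ ∧ 4 * k₁ ≤ m ∧ (m : ℝ) ≤ 288 * k₁ ^ 2 ∧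
      4 * y ^ 4 ≤ m / (288 * k₁ ^ 2) * k₂ / 64 ∧
      4 * y ^ 4 ≤ x ^ 2 * m ^ 2 / (10240 * k₁ ^ 2) ∧
      2 * k₁ * y ^ 4 - x ^ 2 * k₁ ^ 2 / 4 ≤ -(y ^ 11 / x + 3) ∧
      k₂ * y ^ 4 - x ^ 2 * m / 512 ≤ -(y ^ 11 / x + 3) := by
  have hy0 : 0 < y := by linarith
  have hyp : ∀ i : ℕ, (1 / 2 : ℝ) ^ i ≤ y ^ i := fun i => pow_le_pow_left₀ (by norm_num) hy i
  have hy4 := hyp 4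
  have hy7 := hyp 7
  have hy8 := hyp 8
  have hy11 := hyp 11
  have hy15 := hyp 15
  have hx2 : x ^ 2 ≤ x := by nlinarith
  have hx3 : x ^ 3 ≤ x ^ 2 := by nlinarith [sq_nonneg x]
  have hm0 : (0 : ℝ) < m := by
    have : 0 < m * x ^ 3 := lt_of_lt_of_le (by positivity) hm
    exact pos_of_mul_pos_left this (by positivity)
  set V := y ^ 11 / x with hV
  have hVx : V * x = y ^ 11 := by rw [hV]; field_simp
  have hV0 : y ^ 11 ≤ V := by rw [hV, le_div_iff₀ hx0]; nlinarith [pow_pos hy0 11]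
  set K : ℝ := m * x / (2 ^ 14 * y ^ 4) with hK
  have hK0 : 0 ≤ K := by positivity
  have hKm : K * (2 ^ 14 * y ^ 4) = m * x := by rw [hK]; field_simp
  have hKlow : 2 ^ 46 * y ^ 15 ≤ K * x ^ 2 := by
    have h1 : 2 ^ 14 * y ^ 4 * (2 ^ 46 * y ^ 15) ≤ 2 ^ 14 * y ^ 4 * (K * x ^ 2) := by
      have : 2 ^ 14 * y ^ 4 * (K * x ^ 2) = m * x ^ 3 := by linear_combination x ^ 2 * hKm
      rw [this]
      refine le_trans (le_of_eq ?_) hm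
      ring
    exact le_of_mul_le_mul_left h1 (by positivity)
  have hK2 : 2 ≤ K := by nlinarith
  set k₁ := ⌊K⌋₊ with hk₁
  have hka : (k₁ : ℝ) ≤ K := Nat.floor_le hK0
  have hkb : K / 2 ≤ k₁ := by linarith [Nat.lt_floor_add_one K]
  have hk1 : (1 : ℝ) ≤ k₁ := by linarith
  have hk0 : (0 : ℝ) < k₁ := by linarith
  have ha : 2 ^ 14 * y ^ 4 * k₁ ≤ m * x := by rw [← hKm, mul_comm]; gcongr
  have hb : m * x ≤ 2 ^ 15 * y ^ 4 * k₁ := by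
    rw [← hKm]; nlinarith [pow_pos hy0 4]
  have hd : 2 ^ 45 * y ^ 15 ≤ k₁ * x ^ 2 := by nlinarith [sq_nonneg x]
  have ha2 : 2 ^ 28 * y ^ 8 * k₁ ^ 2 ≤ (m * x) ^ 2 := by
    refine (le_of_eq ?_).trans (pow_le_pow_left₀ (by positivity) ha 2)
    ring
  have hb2 : (m * x) ^ 2 ≤ 2 ^ 30 * y ^ 8 * k₁ ^ 2 := by
    refine (pow_le_pow_left₀ (by positivity) hb 2).trans_eq ?_
    ring
  have hmx : 2 ^ 52 * V ≤ m * x ^ 2 := by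
    have h1 : 2 ^ 52 * V * x ≤ m * x ^ 2 * x := by
      have h2 : 2 ^ 52 * y ^ 11 ≤ 2 ^ 60 * y ^ 19 := by
        have := mul_le_mul_of_nonneg_left hy8 (by positivity : 0 ≤ 2 ^ 60 * y ^ 11)
        refine (le_of_eq ?_).trans (this.trans_eq ?_) <;> ring
      linear_combination hm + h2 + 2 ^ 52 * hVx
    exact le_of_mul_le_mul_right h1 hx0
  have hV3 : 3 ≤ 2 ^ 13 * V := by linarith
  refine ⟨k₁, ⌈256 * y ^ 4 * (288 * k₁ ^ 2) / m⌉₊, by exact_mod_cast hk0,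
    Nat.ceil_pos.2 (by positivity), ?_, ?_, ?_, ?_, ?_, ?_⟩
  · have h1 : (4 * k₁ : ℝ) ≤ m := by nlinarith
    exact_mod_cast h1
  · have h1 : 2 ^ 30 * y ^ 8 ≤ m * x ^ 2 := by
      have h2 : 2 ^ 30 * y ^ 8 ≤ 2 ^ 60 * y ^ 19 := by
        have := mul_le_mul_of_nonneg_left hy11 (by positivity : 0 ≤ 2 ^ 60 * y ^ 8)
        refine le_trans ?_ (this.trans_eq (by ring))
        nlinarith [pow_pos hy0 8]
      calc _ ≤ m * x ^ 3 := h2.trans hm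
        _ ≤ _ := by gcongr
    have h3 : 2 ^ 30 * y ^ 8 * m ≤ 2 ^ 30 * y ^ 8 * k₁ ^ 2 := by
      refine le_trans ?_ hb2
      have := mul_le_mul_of_nonneg_right h1 hm0.le
      linarith
    have h4 := le_of_mul_le_mul_left h3 (by positivity)
    nlinarith
  · have h1 := Nat.le_ceil (256 * y ^ 4 * (288 * (k₁ : ℝ) ^ 2) / m)
    calc 4 * y ^ 4 = m / (288 * k₁ ^ 2) * (256 * y ^ 4 * (288 * k₁ ^ 2) / m) / 64 := by
          field_simp; norm_num
      _ ≤ _ := by gcongr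
  · rw [le_div_iff₀ (by positivity)]
    have h1 : 4 * y ^ 4 * (10240 * k₁ ^ 2) ≤ 2 ^ 28 * y ^ 8 * k₁ ^ 2 := by
      have h2 : (40960 : ℝ) ≤ 2 ^ 28 * y ^ 4 := by linarith
      have := mul_le_mul_of_nonneg_right h2 (by positivity : 0 ≤ y ^ 4 * (k₁ : ℝ) ^ 2)
      linarith
    linarith
  · have h1 : 16 * y ^ 4 ≤ x ^ 2 * k₁ := by
      have := mul_le_mul_of_nonneg_left hy11 (by positivity : 0 ≤ 2 ^ 45 * y ^ 4)
      have : 16 * y ^ 4 ≤ 2 ^ 45 * y ^ 15 := by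
        refine le_trans ?_ (this.trans_eq (by ring))
        nlinarith [pow_pos hy0 4]
      linarith
    have h2 := mul_le_mul_of_nonneg_right h1 hk0.le
    have h3 : (2 : ℝ) ^ 30 ≤ k₁ * x := by
      have : (2 : ℝ) ^ 30 ≤ 2 ^ 45 * y ^ 15 := by linarith
      have : k₁ * x ^ 2 ≤ k₁ * x := by gcongr
      linarith
    have h4 : 2 ^ 41 * y ^ 11 ≤ k₁ * x ^ 2 := by
      have := mul_le_mul_of_nonneg_left hy4 (by positivity : 0 ≤ 2 ^ 45 * y ^ 11)
      refine le_trans ?_ hd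
      refine (le_of_eq ?_).trans (this.trans_eq ?_) <;> ring
    have h5 : 2 ^ 71 * V ≤ x ^ 2 * k₁ ^ 2 := by
      have h6 : 2 ^ 71 * V * x ≤ x ^ 2 * k₁ ^ 2 * x := by
        have := mul_le_mul h4 h3 (by positivity) (by positivity)
        linear_combination this + 2 ^ 71 * hVx
      exact le_of_mul_le_mul_right h6 hx0
    linarith
  · have h1 := (Nat.ceil_lt_add_one (by positivity :
      0 ≤ 256 * y ^ 4 * (288 * (k₁ : ℝ) ^ 2) / m)).le
    have h2 := mul_le_mul_of_nonneg_right h1 (by positivity : 0 ≤ y ^ 4)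
    have h3 : 256 * y ^ 4 * (288 * (k₁ : ℝ) ^ 2) / m * y ^ 4 ≤ 73728 / 2 ^ 28 * (m * x ^ 2) := by
      rw [div_mul_eq_mul_div, div_le_iff₀ hm0]
      linear_combination (73728 / 2 ^ 28) * ha2
    have h4 : y ^ 4 ≤ 2 ^ 7 * V := by
      have := mul_le_mul_of_nonneg_left hy7 (by positivity : 0 ≤ 2 ^ 7 * y ^ 4)
      have : y ^ 4 ≤ 2 ^ 7 * y ^ 11 := by
        refine (le_of_eq ?_).trans (this.trans_eq ?_) <;> ring
      linarith
    linarith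

end Assembly

section Threshold

variable {G : Type*} [AddCommGroup G] [Fintype G] [DecidableEq G]

/-- Sets of size at least `2 ^ 60 * y ^ 19 / x ^ 3` are unlikely to be independent, where
`p = x ^ 2` and `log |G| = y ^ 4`. -/
lemma bernoulliProb_exists_independent_card_eq_le_exp {x y : ℝ} {m : ℕ} (hx0 : 0 < x)
    (hx : x ^ 2 ≤ 1 / 2) (hy0 : 0 ≤ y) (hG : 2 ≤ Fintype.card G)
    (hy : y ^ 4 = Real.log (Fintype.card G)) (hm : 2 ^ 60 * y ^ 19 ≤ m * x ^ 3) :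
    bernoulliProb (x ^ 2) Finset.univ (fun S : Finset G => ∃ B : Finset G, B.card = m ∧
        (B + B) ∩ S = ∅) ≤ Real.exp (-(y ^ 11 / x)) := by
  have hG' : (2 : ℝ) ≤ Fintype.card G := by exact_mod_cast hG
  have hx1 : x ≤ 1 := by nlinarith
  have hlog : Real.log 2 ≤ y ^ 4 := hy ▸ Real.log_le_log two_pos hG'
  have hy2 : 1 / 2 ≤ y := by
    by_contra! h
    have := pow_le_pow_left₀ hy0 h.le 4
    have := Real.log_two_gt_d9
    norm_num at *
    linarith
  have hcard : (Fintype.card G : ℝ) = Real.exp (y ^ 4) := by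
    rw [hy, Real.exp_log (by linarith)]
  have hsmall : ∀ u : ℝ, 4 * y ^ 4 ≤ u →
      4 * (Fintype.card G : ℝ) * Real.exp (-u) ≤ 1 / 2 := fun u hu => by
    have h8 : (8 : ℝ) ≤ Real.exp (3 * y ^ 4) := by
      have : Real.exp (3 * y ^ 4) = (Fintype.card G : ℝ) ^ 3 := by
        rw [hcard, ← Real.exp_nat_mul]; norm_num
      rw [this]
      have := pow_le_pow_left₀ zero_le_two hG' 3
      linarith
    calc 4 * (Fintype.card G : ℝ) * Real.exp (-u)
        ≤ 4 * (Fintype.card G : ℝ) * Real.exp (-(4 * y ^ 4)) := by gcongr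
      _ = 4 * (Real.exp (3 * y ^ 4))⁻¹ := by
          rw [hcard, mul_assoc, ← Real.exp_add, ← Real.exp_neg]; ring_nf
      _ ≤ 4 * (8 : ℝ)⁻¹ := by gcongr
      _ = 1 / 2 := by norm_num
  obtain ⟨k₁, k₂, hk₁, hk₂, hk₁m, hmk₁, h₁, h₂, h₃, h₄⟩ := exists_sample_sizes hx0 hx1 hy2 hm
  refine (bernoulliProb_exists_independent_card_eq_le (by positivity) hx hk₁ hk₂ hk₁m hmk₁
    ((hsmall _ h₁).trans_lt (by norm_num)) (hsmall _ h₂)).trans ?_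
  have e₁ : (Fintype.card G : ℝ) ^ (2 * k₁) * Real.exp (-(x ^ 2 * k₁ ^ 2 / 4)) ≤
      Real.exp (-(y ^ 11 / x + 3)) := by
    rw [hcard, ← Real.exp_nat_mul, ← Real.exp_add]
    refine Real.exp_le_exp.2 (le_trans (le_of_eq ?_) h₃)
    push_cast
    ring
  have e₂ : (Fintype.card G : ℝ) ^ k₂ * (2 * Real.exp (-(x ^ 2 * m / 512))) ≤
      2 * Real.exp (-(y ^ 11 / x + 3)) := by
    rw [hcard, ← Real.exp_nat_mul, mul_left_comm, ← Real.exp_add]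
    refine mul_le_mul_of_nonneg_left (Real.exp_le_exp.2 ?_) zero_le_two
    linarith
  have e₃ : 3 * Real.exp (-3) ≤ 1 := by
    rw [Real.exp_neg, mul_inv_le_iff₀ (Real.exp_pos _), one_mul]
    have := Real.add_one_le_exp (3 : ℝ)
    linarith
  have e₄ : Real.exp (-(y ^ 11 / x + 3)) = Real.exp (-(y ^ 11 / x)) * Real.exp (-3) := by
    rw [← Real.exp_add]; ring_nf
  have := mul_le_mul_of_nonneg_left e₃ (Real.exp_pos (-(y ^ 11 / x))).le
  linarith

lemma one_sub_exp_le_bernoulliProb_independent {x y : ℝ} (hx0 : 0 < x) (hx : x ^ 2 ≤ 1 / 2)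
    (hy0 : 0 ≤ y) (hG : 2 ≤ Fintype.card G) (hy : y ^ 4 = Real.log (Fintype.card G)) :
    1 - Real.exp (-(y ^ 11 / x)) ≤ bernoulliProb (x ^ 2) Finset.univ (fun S : Finset G =>
      ∀ B : Finset G, (B + B) ∩ S = ∅ → (B.card : ℝ) ≤ 2 ^ 60 * y ^ 19 / x ^ 3) := by
  have hT0 : 0 ≤ 2 ^ 60 * y ^ 19 / x ^ 3 := by positivity
  set T : ℝ := 2 ^ 60 * y ^ 19 / x ^ 3 with hT
  clear_value T
  have hm : 2 ^ 60 * y ^ 19 ≤ ((⌊T⌋₊ + 1 : ℕ) : ℝ) * x ^ 3 := by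
    rw [← div_le_iff₀ (by positivity), ← hT]
    push_cast
    exact (Nat.lt_floor_add_one T).le
  have hE := bernoulliProb_exists_independent_card_eq_le_exp hx0 hx hy0 hG hy hm
  refine (sub_le_sub_left hE 1).trans ?_
  rw [← bernoulliProb_not]
  refine bernoulliProb_mono (by positivity) (by linarith) fun S _ hS B hB => ?_
  by_contra! hlt
  obtain ⟨C, hCB, hC⟩ := Finset.exists_subset_card_eq
    (Nat.succ_le_of_lt ((Nat.floor_lt hT0).2 hlt))
  refine hS ⟨C, hC, ?_⟩
  rw [← Finset.subset_empty, ← hB]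
  exact Finset.inter_subset_inter_right (Finset.add_subset_add hCB hCB)

end Threshold

/-- whp bound on the independence number of the random Cayley sum graph
`G⁺(p)`, where each element of `G` is included in the random set `S` independently with
probability `p`, and `B` is independent iff `(B + B) ∩ S = ∅`. -/
theorem stmt1 :
    ∃ ξ c : ℝ, 0 < ξ ∧ 0 < c ∧
      ∀ (G : Type) [AddCommGroup G] [Fintype G] [DecidableEq G],
        2 ≤ Fintype.card G →
        ∀ p : ℝ, 0 < p → p ≤ 1 / 2 →
          let n : ℕ := Fintype.card G
          (∑ S ∈ (Finset.univ : Finset G).powerset,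
              (if ∀ B : Finset G,
                    (B + B) ∩ S = ∅ →
                    (B.card : ℝ) ≤ ξ * p ^ (-(3 : ℝ) / 2) * Real.log n ^ ((19 : ℝ) / 4)
                then p ^ S.card * (1 - p) ^ (n - S.card) else 0))
            ≥ 1 - Real.exp (-c * p ^ (-(1 : ℝ) / 2) * Real.log n ^ ((11 : ℝ) / 4)) := by
  refine ⟨2 ^ 60, 1, by positivity, one_pos, ?_⟩
  intro G _ _ _ hG p hp0 hp n
  set L : ℝ := Real.log n with hL
  have hL0 : 0 ≤ L := Real.log_natCast_nonneg n
  set x : ℝ := p ^ ((1 : ℝ) / 2) with hx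
  set y : ℝ := L ^ ((1 : ℝ) / 4) with hy
  have hx0 : 0 < x := Real.rpow_pos_of_pos hp0 _
  have hy0 : 0 ≤ y := Real.rpow_nonneg hL0 _
  have hypow : ∀ k : ℕ, y ^ k = L ^ ((k : ℝ) / 4) := fun k => by
    rw [hy, ← Real.rpow_mul_natCast hL0]; congr 1; ring
  have hxpow : ∀ k : ℕ, x ^ k = p ^ ((k : ℝ) / 2) := fun k => by
    rw [hx, ← Real.rpow_mul_natCast hp0.le]; congr 1; ring
  have hx2 : x ^ 2 = p := by rw [hxpow]; norm_num
  have hy4 : y ^ 4 = L := by rw [hypow]; norm_num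
  have h := one_sub_exp_le_bernoulliProb_independent (G := G) hx0 (by rwa [hx2]) hy0 hG hy4
  have h₁ : -1 * p ^ (-(1 : ℝ) / 2) * L ^ ((11 : ℝ) / 4) = -(y ^ 11 / x) := by
    have e := hypow 11
    push_cast at e
    rw [← e, neg_div, Real.rpow_neg hp0.le, ← hx]
    ring
  have h₂ : 2 ^ 60 * p ^ (-(3 : ℝ) / 2) * L ^ ((19 : ℝ) / 4) = 2 ^ 60 * y ^ 19 / x ^ 3 := by
    have e := hypow 19
    have e' := hxpow 3
    push_cast at e e'
    rw [← e, neg_div, Real.rpow_neg hp0.le, ← e']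
    ring
  rw [h₁, h₂, ge_iff_le]
  refine h.trans_eq (Finset.sum_congr rfl fun S _ => ?_)
  rw [hx2, Finset.card_univ, Set.indicator_apply, mul_ite, mul_one, mul_zero]
  exact if_congr Iff.rfl rfl rfl
end
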